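/- Let f_1, f_2 ∈ B_6 and let f = f_1||f_2 ∈ B_7. If nl_2(f_1) = 18, then nl_2(f) ≤ 40. -/

import Mathlib

open scoped BigOperators

/-- Boolean functions in `n` variables. -/
abbrev BF (n : ℕ) := (Fin n → ZMod 2) → ZMod 2

/-- Hamming distance between two Boolean functions. -/
def hd {n : ℕ} (f g : BF n) : ℕ :=
  (Finset.univ.filter (fun x : Fin n → ZMod 2 => f x ≠ g x)).card

/-- The Reed--Muller code `RM(r,n)`: Boolean functions given by evaluation of a
multivariate polynomial over `F_2` of total degree at most `r`. -/
def RM (r n : ℕ) : Set (BF n) :=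
  {f | ∃ p : MvPolynomial (Fin n) (ZMod 2),
    p.totalDegree ≤ r ∧ ∀ x, f x = MvPolynomial.eval x p}

/-- The `r`-th order nonlinearity of a Boolean function. -/
noncomputable def nl (r : ℕ) {n : ℕ} (f : BF n) : ℕ :=
  sInf {d | ∃ g ∈ RM r n, d = hd f g}

/-- Concatenation `f1 || f2` of two Boolean functions. -/
def concat {n : ℕ} (f1 f2 : BF n) : BF (n + 1) :=
  fun x => (1 + x (Fin.last n)) * f1 (x ∘ Fin.castSucc)
    + x (Fin.last n) * f2 (x ∘ Fin.castSucc)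

/-- A Boolean function is homogeneous quadratic if it is of the form
`∑_{i<j} a_{ij} x_i x_j`. -/
def HomQuad {n : ℕ} (g : BF n) : Prop :=
  ∃ a : Fin n → Fin n → ZMod 2,
    ∀ x, g x = ∑ i : Fin n, ∑ j : Fin n, (if i < j then a i j * x i * x j else 0)

/-- `Fh f r` is the set of homogeneous quadratic functions `g` with `nl(f+g) = r`. -/
def Fh {n : ℕ} (f : BF n) (r : ℕ) : Set (BF n) :=
  {g | HomQuad g ∧ nl 1 (f + g) = r}

/-- `NFh f r = |Fh f r|`. -/
noncomputable def NFh {n : ℕ} (f : BF n) (r : ℕ) : ℕ := (Fh f r).ncard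

/-- The set of 6-variable Boolean functions with nonlinearity 16. -/
def S16 : Set (BF 6) := {f | nl 1 f = 16}

/-- `f1` and `f2` are affine equivalent modulo `RM(r,n)`. -/
def AffEquivMod (r n : ℕ) (f1 f2 : BF n) : Prop :=
  ∃ A : Matrix (Fin n) (Fin n) (ZMod 2), IsUnit A ∧ ∃ b : Fin n → ZMod 2,
    (fun x => f1 x + f2 (A.mulVec x + b)) ∈ RM r n

def fun1 : BF 6 := fun x => x 0*x 1*x 5 + x 0*x 2*x 4 + x 1*x 2*x 3

def fun2 : BF 6 := fun x => x 0*x 1*x 2*x 3 + x 0*x 1*x 5 + x 0*x 3*x 4 + x 1*x 2*x 4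

def fun3 : BF 6 := fun x => x 0*x 1*x 2*x 3 + x 0*x 2*x 4 + x 0*x 3*x 5 + x 1*x 2*x 4
  + x 1*x 2*x 5 + x 1*x 3*x 4

def fun4 : BF 6 := fun x => x 0*x 1*x 2*x 5 + x 0*x 1*x 3*x 4 + x 0*x 2*x 4
  + x 0*x 3*x 4 + x 0*x 3*x 5 + x 1*x 2*x 3

def fun5 : BF 6 := fun x => x 0*x 1*x 2*x 3*x 4 + x 0*x 2*x 4 + x 0*x 3*x 5
  + x 1*x 2*x 4 + x 1*x 2*x 5 + x 1*x 3*x 4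

def fun6 : BF 6 := fun x => x 0*x 1*x 2*x 3*x 4*x 5 + x 0*x 1*x 5 + x 0*x 2*x 4
  + x 1*x 2*x 3

def fun7 : BF 6 := fun x => x 0*x 1*x 2*x 3*x 4*x 5 + x 0*x 1*x 2*x 3 + x 0*x 1*x 5
  + x 0*x 3*x 4 + x 1*x 2*x 4 + x 3*x 4

def fun8 : BF 6 := fun x => x 0*x 1*x 2*x 3*x 4*x 5 + x 0*x 1*x 2*x 3 + x 0*x 2*x 4
  + x 0*x 3*x 5 + x 1*x 2*x 4 + x 1*x 2*x 5 + x 1*x 3*x 4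

def fun9 : BF 6 := fun x => x 0*x 1*x 2*x 3*x 4*x 5 + x 0*x 1*x 2*x 5 + x 0*x 1*x 3*x 4
  + x 0*x 2*x 4 + x 0*x 3*x 4 + x 0*x 3*x 5 + x 1*x 2*x 3 + x 3*x 5

def fun10 : BF 6 := fun x => x 0*x 1*x 2*x 3*x 4*x 5 + x 0*x 1*x 2*x 3 + x 0*x 2*x 3
  + x 0*x 4*x 5 + x 1*x 2*x 3 + x 1*x 2*x 5 + x 1*x 3*x 4 + x 2*x 3 + x 2*x 5 + x 3*x 4

def fun11 : BF 6 := fun x => x 0*x 1*x 2*x 3*x 4*x 5 + x 0*x 1*x 2*x 5 + x 0*x 1*x 3*x 4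
  + x 0*x 2*x 4 + x 0*x 3*x 4 + x 0*x 3*x 5 + x 1*x 2*x 3 + x 1*x 2*x 5 + x 1*x 3*x 4
  + x 2*x 4 + x 3*x 4 + x 3*x 5

def fun12 : BF 6 := fun x => x 0*x 1*x 2*x 3*x 4*x 5 + x 1*x 2*x 3*x 4 + x 0*x 1*x 4*x 5
  + x 0*x 2*x 3*x 5 + x 0*x 1*x 3 + x 0*x 1*x 4 + x 1*x 2*x 4 + x 2*x 3*x 4
  + x 0*x 1*x 5 + x 2*x 3*x 5

def g0 : BF 6 := fun x => x 0*x 1*x 2 + x 0*x 3*x 4 + x 1*x 3*x 5 + x 2*x 4*x 5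
  + x 3*x 4*x 5


theorem RM_mono {r s n : ℕ} (h : r ≤ s) {f : BF n} (hf : f ∈ RM r n) : f ∈ RM s n := by
  obtain ⟨p, hp, h'⟩ := hf
  exact ⟨p, hp.trans h, h'⟩

theorem RM_add {r n : ℕ} {f g : BF n} (hf : f ∈ RM r n) (hg : g ∈ RM r n) : f + g ∈ RM r n := by
  obtain ⟨p, hp, h⟩ := hf
  obtain ⟨q, hq, h'⟩ := hg
  exact ⟨p + q, (MvPolynomial.totalDegree_add p q).trans (max_le hp hq), fun x => by simp [h, h']⟩

theorem RM_mul {r s n : ℕ} {f g : BF n} (hf : f ∈ RM r n) (hg : g ∈ RM s n) :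
    f * g ∈ RM (r + s) n := by
  obtain ⟨p, hp, h⟩ := hf
  obtain ⟨q, hq, h'⟩ := hg
  exact ⟨p * q, (MvPolynomial.totalDegree_mul p q).trans (add_le_add hp hq),
    fun x => by simp [h, h']⟩

theorem RM_const {r n : ℕ} (c : ZMod 2) : (fun _ => c : BF n) ∈ RM r n :=
  ⟨MvPolynomial.C c, by simp, fun x => by simp⟩

theorem RM_one {r n : ℕ} : (1 : BF n) ∈ RM r n := RM_const 1

theorem RM_zero {r n : ℕ} : (0 : BF n) ∈ RM r n := RM_const 0

theorem RM_coord {n : ℕ} (i : Fin n) : (fun x => x i : BF n) ∈ RM 1 n :=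
  ⟨MvPolynomial.X i, by simp, fun x => by simp⟩

theorem RM_sum {ι : Type*} {r n : ℕ} (s : Finset ι) {f : ι → BF n} (hf : ∀ i ∈ s, f i ∈ RM r n) :
    ∑ i ∈ s, f i ∈ RM r n := by
  classical
  induction s using Finset.induction_on with
  | empty => simpa using RM_zero
  | insert a s ha ih =>
    rw [Finset.sum_insert ha]
    exact RM_add (hf a (by simp)) (ih fun i hi => hf i (by simp [hi]))

theorem RM_pow {r n : ℕ} {f : BF n} (hf : f ∈ RM r n) (k : ℕ) : f ^ k ∈ RM (k * r) n := by
  induction k with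
  | zero => rw [pow_zero]; exact RM_one
  | succ k ih => rw [pow_succ, add_mul, one_mul]; exact RM_mul ih hf

theorem RM_prod {ι : Type*} {n : ℕ} (s : Finset ι) {f : ι → BF n} {k : ι → ℕ}
    (hf : ∀ i ∈ s, f i ∈ RM (k i) n) : ∏ i ∈ s, f i ∈ RM (∑ i ∈ s, k i) n := by
  classical
  induction s using Finset.induction_on with
  | empty => rw [Finset.prod_empty]; exact RM_one
  | insert a s ha ih =>
    rw [Finset.prod_insert ha, Finset.sum_insert ha]
    exact RM_mul (hf a (by simp)) (ih fun i hi => hf i (by simp [hi]))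

/-- Reed-Muller codes are preserved by affine substitutions. -/
theorem RM_comp {r m n : ℕ} {f : BF n} (hf : f ∈ RM r n) {σ : (Fin m → ZMod 2) → Fin n → ZMod 2}
    (hσ : ∀ i, (fun x => σ x i) ∈ RM 1 m) : (fun x => f (σ x)) ∈ RM r m := by
  obtain ⟨p, hp, h⟩ := hf
  have : (fun x => f (σ x)) = ∑ d ∈ p.support,
      (fun _ => p.coeff d : BF m) * ∏ i ∈ d.support, (fun x => σ x i : BF m) ^ d i := by
    funext x
    rw [h, MvPolynomial.eval_eq]
    simp
  rw [this]
  refine RM_sum _ fun d hd => ?_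
  have h1 := RM_prod (n := m) d.support (f := fun i => (fun x => σ x i : BF m) ^ d i)
    (k := fun i => d i * 1) fun i _ => RM_pow (hσ i) _
  have h2 := RM_mul (RM_const (r := 0) (n := m) (p.coeff d)) h1
  refine RM_mono ?_ h2
  have := MvPolynomial.le_totalDegree hd
  simp only [Finsupp.sum] at this
  simp only [mul_one, zero_add]
  omega

theorem RM_zero_form {n : ℕ} {f : BF n} (hf : f ∈ RM 0 n) : ∃ c, ∀ x, f x = c := by
  obtain ⟨p, hp, h⟩ := hf
  rw [Nat.le_zero, MvPolynomial.totalDegree_eq_zero_iff_eq_C] at hp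
  exact ⟨p.coeff 0, fun x => by rw [h, hp]; simp⟩

theorem RM_succ_form {r n : ℕ} {f : BF n} (hf : f ∈ RM (r + 1) n) :
    ∃ (c : ZMod 2) (g : Fin n → BF n), (∀ i, g i ∈ RM r n) ∧
      ∀ x, f x = c + ∑ i, x i * g i x := by
  obtain ⟨p, hp, h⟩ := hf
  suffices H : ∀ s : Finset (Fin n →₀ ℕ), s ⊆ p.support →
      ∃ (c : ZMod 2) (g : Fin n → BF n), (∀ i, g i ∈ RM r n) ∧ ∀ x : Fin n → ZMod 2,
        ∑ d ∈ s, p.coeff d * ∏ i ∈ d.support, x i ^ d i = c + ∑ i, x i * g i x by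
    obtain ⟨c, g, hg, hu⟩ := H _ subset_rfl
    exact ⟨c, g, hg, fun x => by rw [h, MvPolynomial.eval_eq, hu]⟩
  intro s
  induction s using Finset.induction_on with
  | empty => exact fun _ => ⟨0, 0, fun i => RM_zero, by simp⟩
  | insert d s hd ih =>
    intro hs
    obtain ⟨c, g, hg, hu⟩ := ih ((Finset.subset_insert _ _).trans hs)
    have hdeg := (MvPolynomial.le_totalDegree (hs (Finset.mem_insert_self d s))).trans hp
    simp only [Finset.sum_insert hd, hu]
    by_cases h0 : d = 0
    · subst h0
      refine ⟨c + p.coeff 0, g, hg, fun x => ?_⟩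
      simp; ring
    · obtain ⟨i, hi⟩ := Finsupp.support_nonempty_iff.2 h0
      have hi' : d i ≠ 0 := Finsupp.mem_support_iff.1 hi
      let m : BF n := ∏ j ∈ d.support.erase i, (fun x => x j : BF n) ^ d j
      have hm : m ∈ RM (∑ j ∈ d.support.erase i, d j * 1) n :=
        RM_prod _ fun j _ => RM_pow (RM_coord j) _
      have hk := RM_mul (RM_const (r := 0) (n := n) (p.coeff d))
        (RM_mul (RM_pow (RM_coord i) (d i - 1)) hm)
      have hdsum : d i + ∑ j ∈ d.support.erase i, d j ≤ r + 1 := by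
        rw [Finset.add_sum_erase _ _ hi]; exact hdeg
      replace hk := RM_mono (s := r) (by simp only [mul_one]; omega) hk
      refine ⟨c, g + Pi.single (M := fun _ => BF n) i
        ((fun _ => p.coeff d) * ((fun x => x i : BF n) ^ (d i - 1) * m)),
        fun j => ?_, fun x => ?_⟩
      · by_cases hj : j = i
        · subst hj; simpa using RM_add (hg j) hk
        · simpa [hj] using hg j
      · have e : ∀ j, x j * (g + Pi.single (M := fun _ => BF n) i
            ((fun _ => p.coeff d) * ((fun x => x i : BF n) ^ (d i - 1) * m))) j x =
            x j * g j x + if j = i then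
              x i * (p.coeff d * (x i ^ (d i - 1) * m x)) else 0 := by
          intro j
          by_cases hj : j = i
          · subst hj; simp [mul_add]
          · simp [hj]
        simp only [e, Finset.sum_add_distrib, Finset.sum_ite_eq', Finset.mem_univ, if_true]
        rw [← Finset.mul_prod_erase _ _ hi]
        have : x i ^ d i = x i * x i ^ (d i - 1) := by
          rw [← pow_succ', Nat.sub_add_cancel (Nat.one_le_iff_ne_zero.2 hi')]
        rw [this]
        simp only [m, Finset.prod_apply, Pi.pow_apply]
        ring

theorem RM_one_form {n : ℕ} {f : BF n} (hf : f ∈ RM 1 n) :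
    ∃ (u : Fin n → ZMod 2) (c : ZMod 2), ∀ x, f x = u ⬝ᵥ x + c := by
  obtain ⟨c, g, hg, h⟩ := RM_succ_form hf
  choose u hu using fun i => RM_zero_form (hg i)
  refine ⟨u, c, fun x => ?_⟩
  simp only [h, hu, dotProduct, mul_comm, add_comm]

theorem RM_two_form {n : ℕ} {f : BF n} (hf : f ∈ RM 2 n) :
    ∃ (A : Fin n → Fin n → ZMod 2) (u : Fin n → ZMod 2) (c : ZMod 2),
      ∀ x, f x = (∑ i, ∑ j, A i j * (x i * x j)) + u ⬝ᵥ x + c := by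
  obtain ⟨c, g, hg, h⟩ := RM_succ_form hf
  choose u d hu using fun i => RM_one_form (hg i)
  refine ⟨u, d, c, fun x => ?_⟩
  simp only [h, hu, dotProduct, mul_add, Finset.sum_add_distrib, Finset.mul_sum]
  rw [add_comm c]
  congr 2
  · exact Finset.sum_congr rfl fun i _ => Finset.sum_congr rfl fun j _ => by ring
  · exact Finset.sum_congr rfl fun i _ => by ring

theorem RM_linear {n : ℕ} (u : Fin n → ZMod 2) (c : ZMod 2) :
    (fun x => u ⬝ᵥ x + c : BF n) ∈ RM 1 n := by
  have : (fun x => u ⬝ᵥ x + c : BF n) =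
      (∑ i, (fun _ => u i : BF n) * (fun x => x i : BF n)) + fun _ => c := by
    funext x; simp [dotProduct]
  rw [this]
  refine RM_add (RM_sum _ fun i _ => ?_) (RM_const c)
  simpa using RM_mul (RM_const (r := 0) (u i)) (RM_coord i)

theorem BF_add_self {n : ℕ} (f : BF n) : f + f = 0 := by
  funext x; exact CharTwo.add_self_eq_zero _

theorem vec_add_self {n : ℕ} (x : Fin n → ZMod 2) : x + x = 0 := by
  funext i; exact CharTwo.add_self_eq_zero _

/-- Append one coordinate. -/
def sn {n : ℕ} (x : Fin n → ZMod 2) (s : ZMod 2) : Fin (n + 1) → ZMod 2 :=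
  Fin.snoc (α := fun _ => ZMod 2) x s

@[simp] theorem sn_castSucc {n : ℕ} (x : Fin n → ZMod 2) (s : ZMod 2) (i : Fin n) :
    sn x s i.castSucc = x i := by simp [sn]

@[simp] theorem sn_last {n : ℕ} (x : Fin n → ZMod 2) (s : ZMod 2) :
    sn x s (Fin.last n) = s := by simp [sn]

@[simp] theorem sn_comp {n : ℕ} (x : Fin n → ZMod 2) (s : ZMod 2) :
    sn x s ∘ Fin.castSucc = x := by funext i; simp

theorem sn_eta {n : ℕ} (y : Fin (n + 1) → ZMod 2) : sn (y ∘ Fin.castSucc) (y (Fin.last n)) = y := by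
  funext i
  refine Fin.lastCases ?_ (fun i => ?_) i <;> simp

theorem sn_dot {n : ℕ} (x y : Fin n → ZMod 2) (s t : ZMod 2) :
    sn x s ⬝ᵥ sn y t = x ⬝ᵥ y + s * t := by
  simp [dotProduct, Fin.sum_univ_castSucc]

theorem sum_ZMod_two {M : Type*} [AddCommMonoid M] (F : ZMod 2 → M) : ∑ s, F s = F 0 + F 1 :=
  Fin.sum_univ_two F

theorem sum_sn {n : ℕ} {M : Type*} [AddCommMonoid M] (F : (Fin (n + 1) → ZMod 2) → M) :
    ∑ y, F y = ∑ x, F (sn x 0) + ∑ x, F (sn x 1) := by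
  rw [← (Fin.snocEquiv fun _ : Fin (n + 1) => ZMod 2).sum_comp, Fintype.sum_prod_type,
    sum_ZMod_two]
  rfl

/-- The restriction to the hyperplane where the last coordinate vanishes. -/
def lo {n : ℕ} (f : BF (n + 1)) : BF n := fun x => f (sn x 0)

/-- The restriction to the hyperplane where the last coordinate is one. -/
def hi {n : ℕ} (f : BF (n + 1)) : BF n := fun x => f (sn x 1)

@[simp] theorem concat_sn_zero {n : ℕ} (a b : BF n) (x) : concat a b (sn x 0) = a x := by
  simp [concat]

@[simp] theorem concat_sn_one {n : ℕ} (a b : BF n) (x) : concat a b (sn x 1) = b x := by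
  have : (1 : ZMod 2) + 1 = 0 := by decide
  simp [concat, this]

theorem BF_ext_sn {n : ℕ} {f g : BF (n + 1)} (h0 : ∀ x, f (sn x 0) = g (sn x 0))
    (h1 : ∀ x, f (sn x 1) = g (sn x 1)) : f = g := by
  funext y
  rw [← sn_eta y]
  generalize y (Fin.last n) = s
  fin_cases s
  · exact h0 _
  · exact h1 _

theorem concat_lo_hi {n : ℕ} (f : BF (n + 1)) : concat (lo f) (hi f) = f :=
  BF_ext_sn (by simp [lo]) (by simp [hi])

theorem concat_add {n : ℕ} (a b c d : BF n) : concat a b + concat c d = concat (a + c) (b + d) :=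
  BF_ext_sn (by simp) (by simp)

theorem concat_mem {n r : ℕ} {q l : BF n} (hq : q ∈ RM (r + 1) n) (hl : l ∈ RM r n) :
    concat q (q + l) ∈ RM (r + 1) (n + 1) := by
  have e : concat q (q + l) = (fun x => q (x ∘ Fin.castSucc)) +
      (fun x => x (Fin.last n)) * (fun x => l (x ∘ Fin.castSucc)) :=
    BF_ext_sn (by simp) (by simp)
  rw [e]
  refine RM_add (RM_comp hq fun i => RM_coord _) ?_
  rw [add_comm r]
  exact RM_mul (RM_coord _) (RM_comp hl fun i => RM_coord _)

theorem sn_coord_mem {n : ℕ} (s : ZMod 2) (i : Fin (n + 1)) :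
    (fun x => sn x s i : BF n) ∈ RM 1 n := by
  refine Fin.lastCases ?_ (fun i => ?_) i
  · simpa using RM_const s
  · simpa using RM_coord i

theorem lo_mem {n r : ℕ} {f : BF (n + 1)} (hf : f ∈ RM r (n + 1)) : lo f ∈ RM r n :=
  RM_comp hf (sn_coord_mem 0)

theorem hi_mem {n r : ℕ} {f : BF (n + 1)} (hf : f ∈ RM r (n + 1)) : hi f ∈ RM r n :=
  RM_comp hf (sn_coord_mem 1)

theorem lo_add_hi_mem {n r : ℕ} {f : BF (n + 1)} (hf : f ∈ RM (r + 1) (n + 1)) :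
    lo f + hi f ∈ RM r n := by
  induction r generalizing f with
  | zero =>
    obtain ⟨c, g, hg, h⟩ := RM_succ_form hf
    choose u hu using fun i => RM_zero_form (hg i)
    rw [show lo f + hi f = fun _ => u (Fin.last n) from ?_]
    · exact RM_const _
    funext x
    simp only [Pi.add_apply, lo, hi, h, hu, Fin.sum_univ_castSucc, sn_castSucc, sn_last]
    generalize ∑ i : Fin n, x i * _ = t
    generalize u (Fin.last n) = v
    clear h
    revert c t v; decide
  | succ r ih =>
    obtain ⟨c, g, hg, h⟩ := RM_succ_form hf
    have e : lo f + hi f = hi (g (Fin.last n)) +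
        ∑ i : Fin n, (fun x => x i : BF n) * (lo (g i.castSucc) + hi (g i.castSucc)) := by
      funext x
      simp only [Pi.add_apply, lo, hi, h, Fin.sum_univ_castSucc, sn_castSucc, sn_last,
        Finset.sum_apply, Pi.mul_apply, mul_add, Finset.sum_add_distrib]
      generalize ∑ i : Fin n, x i * _ = s
      generalize ∑ i : Fin n, x i * _ = t
      generalize g _ _ = v
      generalize g _ _ = w
      have key : ∀ c s t v w : ZMod 2, c + (s + 0 * v) + (c + (t + 1 * w)) = w + (s + t) := by
        decide
      exact key c s t v w
    rw [e]
    refine RM_add (hi_mem (hg _)) (RM_sum _ fun i _ => ?_)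
    rw [add_comm r]
    exact RM_mul (RM_coord i) (ih (hg _))

theorem nl_le {r n : ℕ} {f g : BF n} (hg : g ∈ RM r n) : nl r f ≤ hd f g :=
  Nat.sInf_le ⟨g, hg, rfl⟩

theorem nl_attained (r : ℕ) {n : ℕ} (f : BF n) : ∃ g ∈ RM r n, nl r f = hd f g :=
  Nat.sInf_mem (s := {d | ∃ g ∈ RM r n, d = hd f g}) ⟨_, 0, RM_zero, rfl⟩

theorem hd_add_left {n : ℕ} (f g h : BF n) : hd (f + g) h = hd f (g + h) := by
  unfold hd
  congr 1
  ext x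
  simp only [Finset.mem_filter, Finset.mem_univ, true_and, Pi.add_apply]
  generalize f x = a
  generalize g x = b
  generalize h x = c
  revert a b c; decide

theorem hd_concat {n : ℕ} (a b c d : BF n) : hd (concat a b) (concat c d) = hd a c + hd b d := by
  simp only [hd, Finset.card_filter]
  rw [sum_sn]
  simp

theorem nl_concat_le {n : ℕ} {a b q l : BF n} (hq : q ∈ RM 2 n) (hl : l ∈ RM 1 n) :
    nl 2 (concat a b) ≤ hd a q + hd (b + q) l := by
  rw [hd_add_left, ← hd_concat]
  exact nl_le (concat_mem hq hl)

theorem nl_concat_le' {n : ℕ} {a b q l : BF n} (hq : q ∈ RM 2 n) (hl : l ∈ RM 1 n) :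
    nl 2 (concat a b) ≤ hd b q + hd (a + q) l := by
  have := nl_concat_le (a := a) (b := b) (RM_add hq (RM_mono one_le_two hl)) hl
  rwa [hd_add_left, add_assoc, BF_add_self, add_zero, add_comm (hd a _), ← hd_add_left] at this

theorem hd_comp {n : ℕ} {σ : (Fin n → ZMod 2) → Fin n → ZMod 2} (hσ : Function.Involutive σ)
    (f g : BF n) : hd (f ∘ σ) (g ∘ σ) = hd f g := by
  simp only [hd, Finset.card_filter]
  exact Equiv.sum_comp hσ.toPerm fun x => if f x ≠ g x then 1 else 0

theorem nl_comp {r n : ℕ} {σ : (Fin n → ZMod 2) → Fin n → ZMod 2} (hσ : Function.Involutive σ)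
    (hm : ∀ i, (fun x => σ x i : BF n) ∈ RM 1 n) (f : BF n) : nl r (f ∘ σ) = nl r f := by
  have key : ∀ f : BF n, nl r (f ∘ σ) ≤ nl r f := by
    intro f
    obtain ⟨g, hg, h⟩ := nl_attained r f
    rw [h, ← hd_comp hσ]
    exact nl_le (RM_comp hg hm)
  refine le_antisymm (key f) ?_
  have := key (f ∘ σ)
  rwa [Function.comp_assoc, hσ.comp_self] at this

/-- The sign character of `ZMod 2`. -/
def chi (a : ZMod 2) : ℤ := if a = 0 then 1 else -1

@[simp] theorem chi_zero : chi 0 = 1 := rfl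

@[simp] theorem chi_one : chi 1 = -1 := rfl

theorem chi_add : ∀ a b : ZMod 2, chi (a + b) = chi a * chi b := by decide

theorem chi_mul_self : ∀ a : ZMod 2, chi a * chi a = 1 := by decide

theorem chi_eq_or : ∀ a : ZMod 2, chi a = 1 ∨ chi a = -1 := by decide

theorem exists_chi_mul (w : ℤ) : ∃ c, chi c * w = |w| := by
  rcases abs_choice w with h | h
  · exact ⟨0, by simp [h]⟩
  · exact ⟨1, by simp [h]⟩

/-- The Walsh-Hadamard transform. -/
def hat {n : ℕ} (F : (Fin n → ZMod 2) → ℤ) (u : Fin n → ZMod 2) : ℤ := ∑ x, F x * chi (u ⬝ᵥ x)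

/-- The Walsh spectrum of a Boolean function. -/
def walsh {n : ℕ} (f : BF n) (u : Fin n → ZMod 2) : ℤ := hat (fun x => chi (f x)) u

theorem walsh_def {n : ℕ} (f : BF n) (u) : walsh f u = ∑ x, chi (f x + u ⬝ᵥ x) := by
  simp [walsh, hat, chi_add]

theorem two_hd {n : ℕ} (f g : BF n) : 2 * (hd f g : ℤ) = 2 ^ n - ∑ x, chi (f x + g x) := by
  have h2 : (2 : ℤ) ^ n = ∑ _x : Fin n → ZMod 2, 1 := by simp
  rw [hd, Finset.card_filter, h2, ← Finset.sum_sub_distrib]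
  push_cast
  rw [Finset.mul_sum]
  refine Finset.sum_congr rfl fun x _ => ?_
  generalize f x = a
  generalize g x = b
  revert a b; decide

theorem two_hd_affine {n : ℕ} (f : BF n) (u : Fin n → ZMod 2) (c : ZMod 2) :
    2 * (hd f (fun x => u ⬝ᵥ x + c) : ℤ) = 2 ^ n - chi c * walsh f u := by
  rw [two_hd, walsh_def, Finset.mul_sum]
  congr 1
  refine Finset.sum_congr rfl fun x _ => ?_
  simp only [chi_add]; ring

theorem exists_affine {n : ℕ} (f : BF n) (u : Fin n → ZMod 2) :
    ∃ l ∈ RM 1 n, 2 * (hd f l : ℤ) = 2 ^ n - |walsh f u| := by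
  obtain ⟨c, hc⟩ := exists_chi_mul (walsh f u)
  exact ⟨_, RM_linear u c, by rw [two_hd_affine, hc]⟩

theorem nl_one_le_walsh {n : ℕ} (f : BF n) (u : Fin n → ZMod 2) :
    2 * (nl 1 f : ℤ) ≤ 2 ^ n - |walsh f u| := by
  obtain ⟨l, hl, h⟩ := exists_affine f u
  have := nl_le (f := f) hl
  omega

theorem walsh_concat {n : ℕ} (a b : BF n) (u : Fin n → ZMod 2) (s : ZMod 2) :
    walsh (concat a b) (sn u s) = walsh a u + chi s * walsh b u := by
  simp only [walsh_def, sum_sn, concat_sn_zero, concat_sn_one, sn_dot, chi_add, Finset.mul_sum]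
  congr 1
  · simp
  · exact Finset.sum_congr rfl fun x _ => by simp; ring

theorem sum_chi_dot {n : ℕ} (x : Fin n → ZMod 2) :
    ∑ u : Fin n → ZMod 2, chi (u ⬝ᵥ x) = if x = 0 then 2 ^ n else 0 := by
  split_ifs with h
  · simp [h]
  · obtain ⟨i, hi⟩ : ∃ i, x i ≠ 0 := by
      by_contra! H; exact h (funext H)
    have hi' : x i = 1 := by
      revert hi; generalize x i = a; revert a; decide
    have : ∑ u : Fin n → ZMod 2, chi (u ⬝ᵥ x) = -∑ u : Fin n → ZMod 2, chi (u ⬝ᵥ x) := by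
      conv_lhs => rw [← Equiv.sum_comp (Equiv.addRight (Pi.single i (1 : ZMod 2)))]
      rw [← Finset.sum_neg_distrib]
      refine Finset.sum_congr rfl fun u _ => ?_
      simp [add_dotProduct, chi_add, hi']
    omega

theorem sum_hat_mul {n : ℕ} (F G : (Fin n → ZMod 2) → ℤ) (a : Fin n → ZMod 2) :
    ∑ u, hat F u * hat G u * chi (u ⬝ᵥ a) = 2 ^ n * ∑ x, F x * G (x + a) := by
  have e : ∀ u, hat F u * hat G u * chi (u ⬝ᵥ a) =
      ∑ x, ∑ y, F x * G y * chi (u ⬝ᵥ (x + y + a)) := by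
    intro u
    rw [hat, hat, Finset.sum_mul_sum]
    simp only [Finset.sum_mul]
    refine Finset.sum_congr rfl fun x _ => Finset.sum_congr rfl fun y _ => ?_
    simp only [dotProduct_add, chi_add]; ring
  simp only [e]
  rw [Finset.sum_comm, Finset.mul_sum]
  refine Finset.sum_congr rfl fun x _ => ?_
  rw [Finset.sum_comm, Finset.sum_eq_single (x + a)]
  · rw [← Finset.mul_sum, sum_chi_dot, if_pos]
    · ring
    · rw [show x + (x + a) + a = (x + x) + (a + a) by abel, vec_add_self, vec_add_self, add_zero]
  · intro y _ hy
    rw [← Finset.mul_sum, sum_chi_dot, if_neg, mul_zero]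
    intro h
    apply hy
    have : y = (x + y + a) + (x + a) := by
      rw [show x + y + a + (x + a) = y + ((x + x) + (a + a)) by abel, vec_add_self, vec_add_self]
      simp
    rw [this, h, zero_add]
  · simp

theorem sum_hat_mul_zero {n : ℕ} (F G : (Fin n → ZMod 2) → ℤ) :
    ∑ u, hat F u * hat G u = 2 ^ n * ∑ x, F x * G x := by
  simpa using sum_hat_mul F G 0

theorem sum_walsh_mul {n : ℕ} (f g : BF n) :
    ∑ u, walsh f u * walsh g u = 2 ^ n * walsh (f + g) 0 := by
  rw [walsh_def]
  simp only [zero_dotProduct, add_zero, Pi.add_apply, chi_add]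
  exact sum_hat_mul_zero (fun x => chi (f x)) fun x => chi (g x)

theorem sum_walsh_sq {n : ℕ} (f : BF n) : ∑ u, walsh f u ^ 2 = 2 ^ n * 2 ^ n := by
  have := sum_walsh_mul f f
  simpa [BF_add_self, walsh_def, ← pow_two] using this

theorem concat_mem_four {n : ℕ} {q l0 l1 l2 l3 : BF n} (hq : q ∈ RM 2 n) (h0 : l0 ∈ RM 1 n)
    (h1 : l1 ∈ RM 1 n) (h2 : l2 ∈ RM 1 n) (hs : l0 + l1 + l2 + l3 ∈ RM 0 n) :
    concat (concat (q + l0) (q + l1)) (concat (q + l2) (q + l3)) ∈ RM 2 (n + 1 + 1) := by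
  have hL := concat_mem (r := 0) (RM_add h0 h2) hs
  have hQ := concat_mem (r := 1) (RM_add hq (RM_mono one_le_two h0)) (RM_add h0 h1)
  have := concat_mem (r := 1) hQ hL
  convert this using 1
  simp only [concat_add]
  have e (a b : BF n) : b = a + (a + b) := by rw [← add_assoc, BF_add_self, zero_add]
  congr 2
  · rw [show q + l0 + (l0 + l1) = q + (l0 + l0) + l1 by abel, BF_add_self, add_zero]
  · rw [show q + l0 + (l0 + l2) = q + (l0 + l0) + l2 by abel, BF_add_self, add_zero]
  · rw [show q + l0 + (l0 + l1) + (l0 + l2 + (l0 + l1 + l2 + l3)) =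
      q + l3 + (l0 + l0) + (l0 + l0) + (l1 + l1) + (l2 + l2) by abel]
    simp [BF_add_self]

theorem nl_two_pieces {n : ℕ} (p0 p1 p2 p3 : BF n) {q : BF n} (hq : q ∈ RM 2 n)
    {u0 u1 u2 u3 : Fin n → ZMod 2} (hu : u0 + u1 + u2 + u3 = 0) :
    2 * (nl 2 (concat (concat p0 p1) (concat p2 p3)) : ℤ) ≤ 4 * 2 ^ n -
      (|walsh (p0 + q) u0| + |walsh (p1 + q) u1| + |walsh (p2 + q) u2| + |walsh (p3 + q) u3|) := by
  obtain ⟨c0, h0⟩ := exists_chi_mul (walsh (p0 + q) u0)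
  obtain ⟨c1, h1⟩ := exists_chi_mul (walsh (p1 + q) u1)
  obtain ⟨c2, h2⟩ := exists_chi_mul (walsh (p2 + q) u2)
  obtain ⟨c3, h3⟩ := exists_chi_mul (walsh (p3 + q) u3)
  have hm := concat_mem_four hq (RM_linear u0 c0) (RM_linear u1 c1) (RM_linear u2 c2)
    (l3 := fun x => u3 ⬝ᵥ x + c3) (by
      rw [show (_ + _ + _ + _ : BF n) = fun _ => c0 + c1 + c2 + c3 from ?_]
      · exact RM_const _
      funext x
      have : u0 ⬝ᵥ x + u1 ⬝ᵥ x + u2 ⬝ᵥ x + u3 ⬝ᵥ x = 0 := by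
        rw [← add_dotProduct, ← add_dotProduct, ← add_dotProduct, hu, zero_dotProduct]
      simp only [Pi.add_apply]
      linear_combination this)
  have := nl_le (f := concat (concat p0 p1) (concat p2 p3)) hm
  simp only [hd_concat, ← hd_add_left] at this
  have e0 := two_hd_affine (p0 + q) u0 c0
  have e1 := two_hd_affine (p1 + q) u1 c1
  have e2 := two_hd_affine (p2 + q) u2 c2
  have e3 := two_hd_affine (p3 + q) u3 c3
  zify at this
  linarith

theorem nl_one_pieces {n : ℕ} (p0 p1 p2 p3 : BF n) (u : Fin n → ZMod 2) (c0 c1 c2 c3 : ZMod 2)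
    (hc : c0 + c1 + c2 + c3 = 0) :
    2 * (nl 1 (concat (concat p0 p1) (concat p2 p3)) : ℤ) ≤ 4 * 2 ^ n -
      |chi c0 * walsh p0 u + chi c1 * walsh p1 u + chi c2 * walsh p2 u + chi c3 * walsh p3 u| := by
  have h := nl_one_le_walsh (concat (concat p0 p1) (concat p2 p3)) (sn (sn u (c0 + c1)) (c0 + c2))
  have hc3 : c3 = c0 + c1 + c2 := by
    revert hc; clear h; revert c0 c1 c2 c3; decide
  have e : |walsh p0 u + chi (c0 + c1) * walsh p1 u +
        chi (c0 + c2) * (walsh p2 u + chi (c0 + c1) * walsh p3 u)| = |chi c0 * walsh p0 u +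
        chi c1 * walsh p1 u + chi c2 * walsh p2 u + chi (c0 + c1 + c2) * walsh p3 u| := by
    simp only [chi_add]
    rcases chi_eq_or c0 with h0 | h0
    · rw [h0]; congr 1; ring
    · rw [h0, ← abs_neg]; congr 1; ring
  rw [walsh_concat, walsh_concat, walsh_concat, e] at h
  rw [hc3]
  refine h.trans (le_of_eq ?_)
  ring

theorem RM_sum_eq_zero {r n : ℕ} (hr : r < n) {f : BF n} (hf : f ∈ RM r n) : ∑ x, f x = 0 := by
  induction n generalizing r with
  | zero => omega
  | succ n ih =>
    have e : ∑ x, f x = ∑ x, (lo f + hi f) x := by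
      rw [sum_sn, ← Finset.sum_add_distrib]; rfl
    rw [e]
    cases r with
    | zero =>
      obtain ⟨c, hc⟩ := RM_zero_form hf
      refine Finset.sum_eq_zero fun x _ => ?_
      simp [lo, hi, hc, CharTwo.add_self_eq_zero]
    | succ r => exact ih (by omega) (lo_add_hi_mem hf)

theorem sum_eq_cast_val {ι : Type*} [Fintype ι] (F : ι → ZMod 2) :
    ((∑ x, ((F x).val : ℤ) : ℤ) : ZMod 2) = ∑ x, F x := by
  push_cast
  simp

theorem walsh_eq {n : ℕ} (hn : 1 < n) (f : BF n) (u : Fin n → ZMod 2) :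
    ∃ k : ℤ, walsh f u = 2 ^ n - 2 * k ∧ (k : ZMod 2) = ∑ x, f x := by
  refine ⟨∑ x, ((f x + u ⬝ᵥ x).val : ℤ), ?_, ?_⟩
  · have h2 : (2 : ℤ) ^ n = ∑ _x : Fin n → ZMod 2, 1 := by simp
    rw [walsh_def, h2, Finset.mul_sum, ← Finset.sum_sub_distrib]
    refine Finset.sum_congr rfl fun x _ => ?_
    generalize f x + u ⬝ᵥ x = a
    revert a; decide
  · rw [sum_eq_cast_val, Finset.sum_add_distrib]
    have := RM_sum_eq_zero hn (RM_linear u 0)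
    simp only [add_zero] at this
    rw [this, add_zero]

theorem walsh_even {f : BF 4} (hf : ∑ x, f x = 0) (u) : ∃ m, walsh f u = 4 * m := by
  obtain ⟨k, hk, h⟩ := walsh_eq (by norm_num) f u
  rw [hf, ZMod.intCast_zmod_eq_zero_iff_dvd] at h
  obtain ⟨m, rfl⟩ := h
  exact ⟨4 - m, by rw [hk]; push_cast; ring⟩

theorem walsh_odd {f : BF 4} (hf : ∑ x, f x = 1) (u) : ∃ m, walsh f u = 4 * m + 2 := by
  obtain ⟨k, hk, h⟩ := walsh_eq (by norm_num) f u
  have h' : ((k - 1 : ℤ) : ZMod 2) = 0 := by push_cast; rw [h, hf]; decide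
  rw [ZMod.intCast_zmod_eq_zero_iff_dvd] at h'
  obtain ⟨m, hm⟩ := h'
  push_cast at hm
  exact ⟨3 - m, by rw [hk]; omega⟩

theorem ZMod_two_cases : ∀ a : ZMod 2, a = 0 ∨ a = 1 := by decide

theorem card_four : (Finset.univ : Finset (Fin 4 → ZMod 2)).card = 16 := by simp

theorem exists_ge_of_sum (F : (Fin 4 → ZMod 2) → ℤ) (c : ℤ) (h : 16 * c ≤ ∑ u, F u) :
    ∃ u, c ≤ F u := by
  obtain ⟨u, -, hu⟩ := Finset.exists_le_of_sum_le (s := Finset.univ) (f := fun _ => c) (g := F)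
    ⟨0, by simp⟩ (by rw [Finset.sum_const, card_four]; simpa using h)
  exact ⟨u, hu⟩

theorem sum_walsh_sq_four (f : BF 4) : ∑ u, walsh f u ^ 2 = 256 := by
  rw [sum_walsh_sq]; norm_num

theorem exists_walsh_four (f : BF 4) : ∃ u, 4 ≤ |walsh f u| := by
  obtain ⟨u, hu⟩ := exists_ge_of_sum (fun u => walsh f u ^ 2) 16 (by rw [sum_walsh_sq_four]; rfl)
  exact ⟨u, abs_le_of_sq_le_sq' (by rw [sq_abs]; exact hu) (abs_nonneg _) |>.2⟩

theorem exists_walsh_six {f : BF 4} (hf : ∑ x, f x = 1) : ∃ u, 6 ≤ |walsh f u| := by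
  obtain ⟨u, hu⟩ := exists_walsh_four f
  obtain ⟨m, hm⟩ := walsh_odd hf u
  refine ⟨u, ?_⟩
  rw [abs_eq_max_neg] at *
  omega

theorem exists_pair_mixed {a b : BF 4} (ha : ∑ x, a x = 1) (hb : ∑ x, b x = 0) :
    ∃ u, 8 ≤ |walsh a u| + |walsh b u| := by
  by_contra! H
  obtain ⟨u, hu⟩ := exists_ge_of_sum (fun u => walsh a u ^ 2 + 2 * walsh b u ^ 2) 48
    (by rw [Finset.sum_add_distrib, ← Finset.mul_sum, sum_walsh_sq_four, sum_walsh_sq_four]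
        norm_num)
  obtain ⟨m, hm⟩ := walsh_odd ha u
  obtain ⟨k, hk⟩ := walsh_even hb u
  have := H u
  simp only [hm, hk, abs_eq_max_neg] at this hu
  have h1 : -2 ≤ m ∧ m ≤ 1 := by omega
  have h2 : -1 ≤ k ∧ k ≤ 1 := by omega
  obtain ⟨h1, h1'⟩ := h1
  obtain ⟨h2, h2'⟩ := h2
  interval_cases m <;> interval_cases k <;> simp_all

theorem exists_pair (a b : BF 4) : ∃ u, 8 ≤ |walsh a u| + |walsh b u| := by
  rcases ZMod_two_cases (∑ x, a x) with ha | ha <;> rcases ZMod_two_cases (∑ x, b x) with hb | hb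
  · by_contra! H
    obtain ⟨u, hu⟩ := exists_ge_of_sum (fun u => walsh a u ^ 2 + walsh b u ^ 2) 32
      (by rw [Finset.sum_add_distrib, sum_walsh_sq_four, sum_walsh_sq_four]; norm_num)
    obtain ⟨m, hm⟩ := walsh_even ha u
    obtain ⟨k, hk⟩ := walsh_even hb u
    have := H u
    simp only [hm, hk, abs_eq_max_neg] at this hu
    have h1 : -1 ≤ m ∧ m ≤ 1 := by omega
    have h2 : -1 ≤ k ∧ k ≤ 1 := by omega
    obtain ⟨h1, h1'⟩ := h1
    obtain ⟨h2, h2'⟩ := h2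
    interval_cases m <;> interval_cases k <;> simp_all
  · obtain ⟨u, hu⟩ := exists_pair_mixed hb ha
    exact ⟨u, by omega⟩
  · exact exists_pair_mixed ha hb
  · obtain ⟨u, hu⟩ := exists_walsh_six ha
    obtain ⟨m, hm⟩ := walsh_odd hb u
    refine ⟨u, ?_⟩
    rw [abs_eq_max_neg] at *
    rw [abs_eq_max_neg]
    omega

theorem exists_walsh_concat_abs {n : ℕ} (a b : BF n) (u : Fin n → ZMod 2) :
    ∃ v, |walsh (concat a b) v| = |walsh a u| + |walsh b u| := by
  obtain ⟨c, hc⟩ := exists_chi_mul (walsh a u)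
  obtain ⟨d, hd⟩ := exists_chi_mul (walsh b u)
  refine ⟨sn u (c + d), ?_⟩
  rw [walsh_concat, chi_add, ← hc, ← hd]
  rcases chi_eq_or c with h | h
  · rw [h] at hc ⊢
    rw [abs_of_nonneg]
    · ring
    · have := abs_nonneg (walsh a u)
      have := abs_nonneg (walsh b u)
      linarith
  · rw [h] at hc ⊢
    rw [abs_of_nonpos]
    · ring
    · have := abs_nonneg (walsh a u)
      have := abs_nonneg (walsh b u)
      linarith

theorem exists_affine_five (g : BF 5) : ∃ l ∈ RM 1 5, hd g l ≤ 12 := by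
  obtain ⟨u, hu⟩ := exists_pair (lo g) (hi g)
  obtain ⟨v, hv⟩ := exists_walsh_concat_abs (lo g) (hi g) u
  rw [concat_lo_hi] at hv
  obtain ⟨l, hl, h⟩ := exists_affine g v
  exact ⟨l, hl, by norm_num at h; omega⟩

theorem exists_affine_four (g : BF 4) : ∃ l ∈ RM 1 4, hd g l ≤ 6 := by
  obtain ⟨u, hu⟩ := exists_walsh_four g
  obtain ⟨l, hl, h⟩ := exists_affine g u
  exact ⟨l, hl, by norm_num at h; omega⟩

theorem exists_affine_four_odd {g : BF 4} (hg : ∑ x, g x = 1) : ∃ l ∈ RM 1 4, hd g l ≤ 5 := by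
  obtain ⟨u, hu⟩ := exists_walsh_six hg
  obtain ⟨l, hl, h⟩ := exists_affine g u
  exact ⟨l, hl, by norm_num at h; omega⟩

theorem eq_interpolation (a : BF 4) (x : Fin 4 → ZMod 2) :
    a x = ∑ y, a y * ∏ i, (x i + (1 + y i)) := by
  rw [Finset.sum_eq_single x]
  · have : ∀ s : ZMod 2, s + (1 + s) = 1 := by decide
    simp [this]
  · intro y _ hy
    obtain ⟨i, hi⟩ : ∃ i, x i ≠ y i := by
      by_contra! H; exact hy (funext H).symm
    rw [Finset.prod_eq_zero (Finset.mem_univ i), mul_zero]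
    revert hi
    generalize x i = s
    generalize y i = t
    revert s t; decide
  · simp

theorem RM_two_of_sums {a : BF 4} (h : ∑ x, a x = 0) (hi : ∀ i, ∑ x, a x * x i = 0) :
    a ∈ RM 2 4 := by
  let X : Fin 4 → BF 4 := fun i x => x i
  let C : ZMod 2 → BF 4 := fun c _ => c
  have hX (i) : X i ∈ RM 1 4 := RM_coord i
  have hX2 (i j) (c : ZMod 2) : C c * (X i * X j) ∈ RM 2 4 :=
    RM_mono (by norm_num) (RM_mul (RM_const (r := 0) c) (RM_mul (hX i) (hX j)))
  have hX1 (i) (c : ZMod 2) : C c * X i ∈ RM 2 4 :=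
    RM_mono (by norm_num) (RM_mul (RM_const (r := 0) c) (hX i))
  have hC (c) : C c ∈ RM 2 4 := RM_const c
  let R : (Fin 4 → ZMod 2) → BF 4 := fun d =>
    C (d 2 * d 3) * (X 0 * X 1) + C (d 1 * d 3) * (X 0 * X 2) + C (d 1 * d 2) * (X 0 * X 3)
    + C (d 0 * d 3) * (X 1 * X 2) + C (d 0 * d 2) * (X 1 * X 3) + C (d 0 * d 1) * (X 2 * X 3)
    + C (d 1 * d 2 * d 3) * X 0 + C (d 0 * d 2 * d 3) * X 1 + C (d 0 * d 1 * d 3) * X 2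
    + C (d 0 * d 1 * d 2) * X 3 + C (d 0 * d 1 * d 2 * d 3)
  have hR (d) : R d ∈ RM 2 4 := by
    refine RM_add (RM_add (RM_add (RM_add (RM_add (RM_add (RM_add (RM_add (RM_add (RM_add
      ?_ ?_) ?_) ?_) ?_) ?_) ?_) ?_) ?_) ?_) ?_ <;> first | exact hX2 _ _ _ | exact hX1 _ _ | exact hC _
  have e : a = ∑ y, C (a y) * R (1 + y) := by
    funext x
    have hi' (i) : ∑ y, a y * (1 + y i) = 0 := by
      simp only [mul_add, mul_one, Finset.sum_add_distrib, h, hi, add_zero]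
    rw [eq_interpolation a x]
    have e' : ∀ y : Fin 4 → ZMod 2, a y * ∏ i, (x i + (1 + y i)) =
        a y * R (1 + y) x + a y * (x 0 * x 1 * x 2 * x 3)
        + a y * (1 + y 0) * (x 1 * x 2 * x 3) + a y * (1 + y 1) * (x 0 * x 2 * x 3)
        + a y * (1 + y 2) * (x 0 * x 1 * x 3) + a y * (1 + y 3) * (x 0 * x 1 * x 2) := by
      intro y
      simp only [Fin.prod_univ_four, R, C, X, Pi.add_apply, Pi.mul_apply, Pi.one_apply]
      ring
    simp only [e', Finset.sum_add_distrib, ← Finset.sum_mul, hi', h, zero_mul, add_zero]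
    simp [C]
  rw [e]
  exact RM_sum _ fun y _ => RM_mono (by norm_num) (RM_mul (RM_const (r := 0) (a y)) (hR _))

theorem exists_delta {a : BF 4} (h : ∑ x, a x = 1) : ∃ p, a + Pi.single p 1 ∈ RM 2 4 := by
  refine ⟨fun i => ∑ x, a x * x i, RM_two_of_sums ?_ fun i => ?_⟩
  · simp only [Pi.add_apply, Finset.sum_add_distrib, h]
    rw [Finset.sum_eq_single (fun i => ∑ x, a x * x i)]
    · simp [CharTwo.add_self_eq_zero]
    · intro y _ hy; simp [hy]
    · simp
  · simp only [Pi.add_apply, add_mul, Finset.sum_add_distrib]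
    rw [Finset.sum_eq_single (fun i => ∑ x, a x * x i) (s := Finset.univ)
      (f := fun x => Pi.single (M := fun _ => ZMod 2) _ _ x * x i)]
    · simp [CharTwo.add_self_eq_zero]
    · intro y _ hy; simp [hy]
    · simp

/-- Even functions in four variables whose Walsh spectrum is bounded by `4` are quadratic. -/
theorem bent_quadratic {b : BF 4} (hb : ∀ u, |walsh b u| ≤ 4) :
    (∀ u, |walsh b u| = 4) ∧ (∑ x, b x = 0 → b ∈ RM 2 4) := by
  have h4 : ∀ u, |walsh b u| = 4 := by
    by_contra! H
    obtain ⟨u, hu⟩ := H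
    have hlt : ∑ u, walsh b u ^ 2 < ∑ _u : Fin 4 → ZMod 2, (16 : ℤ) := by
      refine Finset.sum_lt_sum (fun u _ => ?_) ⟨u, Finset.mem_univ _, ?_⟩
      · have := hb u; rw [← sq_abs]; nlinarith [abs_nonneg (walsh b u)]
      · have := lt_of_le_of_ne (hb u) hu; rw [← sq_abs]; nlinarith [abs_nonneg (walsh b u)]
    rw [sum_walsh_sq_four, Finset.sum_const, card_four] at hlt
    norm_num at hlt
  refine ⟨h4, fun h0 => RM_two_of_sums h0 fun i => ?_⟩
  have key : walsh b 0 - walsh b (Pi.single i 1) = 16 - 4 * ∑ x, ((b x * x i).val : ℤ) := by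
    have h16 : (16 : ℤ) = 2 * ∑ x : Fin 4 → ZMod 2, ((x i).val : ℤ) := by
      revert i; decide
    rw [walsh_def, walsh_def, ← Finset.sum_sub_distrib, h16, Finset.mul_sum, Finset.mul_sum,
      ← Finset.sum_sub_distrib]
    refine Finset.sum_congr rfl fun x _ => ?_
    simp only [zero_dotProduct, single_dotProduct, one_mul, add_zero]
    generalize b x = s
    generalize x i = t
    revert s t; decide
  rw [← sum_eq_cast_val, ZMod.intCast_zmod_eq_zero_iff_dvd]
  have h1 := h4 0
  have h2 := h4 (Pi.single i 1)
  rw [abs_eq_max_neg] at h1 h2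
  push_cast
  omega

theorem sum_involutive {n : ℕ} {σ : (Fin n → ZMod 2) → Fin n → ZMod 2}
    (hσ : Function.Involutive σ) (f F : BF n) :
    ∑ x, (f ∘ σ) x * F x = ∑ y, f y * F (σ y) := by
  rw [← Equiv.sum_comp hσ.toPerm]
  simp [hσ _]

/-- Exchange of two coordinates. -/
def sw {n : ℕ} (i j : Fin n) (x : Fin n → ZMod 2) : Fin n → ZMod 2 := x ∘ Equiv.swap i j

theorem sw_involutive {n : ℕ} (i j : Fin n) : Function.Involutive (sw i j) := by
  intro x; funext k; simp [sw]

theorem sw_mem {n : ℕ} (i j k : Fin n) : (fun x => sw i j x k : BF n) ∈ RM 1 n := RM_coord _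

/-- Transvections. -/
def tv {n : ℕ} (α w x : Fin n → ZMod 2) : Fin n → ZMod 2 := x + (α ⬝ᵥ x) • w

theorem tv_involutive {n : ℕ} {α w : Fin n → ZMod 2} (h : α ⬝ᵥ w = 0) :
    Function.Involutive (tv α w) := by
  intro x
  simp only [tv, dotProduct_add, dotProduct_smul, h, smul_zero, add_zero, add_assoc, vec_add_self]

theorem tv_mem {n : ℕ} (α w : Fin n → ZMod 2) (k : Fin n) : (fun x => tv α w x k : BF n) ∈ RM 1 n := by
  refine RM_add (RM_coord k) (RM_mul (r := 1) (s := 0) ?_ (RM_const (w k)))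
  simpa using RM_linear α 0

theorem tv_sn {n : ℕ} (α w x : Fin n → ZMod 2) (s : ZMod 2) :
    tv (sn α 0) (sn w 0) (sn x s) = sn (tv α w x) s := by
  funext i
  refine Fin.lastCases ?_ (fun i => ?_) i <;> simp [tv, sn_dot]

theorem sum_mul_mem {n : ℕ} {g l : BF n} (h : ∑ x, g x = 0) (hi : ∀ i, ∑ x, g x * x i = 0)
    (hl : l ∈ RM 1 n) : ∑ x, g x * l x = 0 := by
  obtain ⟨u, c, hu⟩ := RM_one_form hl
  simp only [hu, mul_add, Finset.sum_add_distrib, ← Finset.sum_mul, h, zero_mul, add_zero,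
    dotProduct, Finset.mul_sum]
  rw [Finset.sum_comm]
  refine Finset.sum_eq_zero fun i _ => ?_
  have : ∀ x : Fin n → ZMod 2, g x * (u i * x i) = u i * (g x * x i) := fun x => by ring
  simp only [this, ← Finset.mul_sum, hi, mul_zero]

theorem sum_hi {n : ℕ} (f F : BF (n + 1)) :
    ∑ x, f x * x (Fin.last n) * F x = ∑ x, hi f x * F (sn x 1) := by
  rw [sum_sn]
  simp [hi]

theorem alternating_five : ∀ a b c d e f g h i j : ZMod 2, ∃ l : Fin 5 → ZMod 2, l ≠ 0 ∧
    a * l 1 + b * l 2 + c * l 3 + d * l 4 = 0 ∧ a * l 0 + e * l 2 + f * l 3 + g * l 4 = 0 ∧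
    b * l 0 + e * l 1 + h * l 3 + i * l 4 = 0 ∧ c * l 0 + f * l 1 + h * l 2 + j * l 4 = 0 ∧
    d * l 0 + g * l 1 + i * l 2 + j * l 3 = 0 := by decide +kernel

theorem exists_kernel {h : BF 5} (hi : ∀ i, ∑ x, h x * x i = 0) :
    ∃ l : Fin 5 → ZMod 2, l ≠ 0 ∧ ∀ i, ∑ x, h x * (l ⬝ᵥ x) * x i = 0 := by
  let M : Fin 5 → Fin 5 → ZMod 2 := fun i j => ∑ x, h x * x i * x j
  have hM (i j) : M i j = M j i := Finset.sum_congr rfl fun x _ => by ring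
  have hM0 (i) : M i i = 0 := by
    rw [← hi i]
    refine Finset.sum_congr rfl fun x _ => ?_
    rw [mul_assoc]; congr 1
    generalize x i = s; revert s; decide
  obtain ⟨l, hl, h0, h1, h2, h3, h4⟩ := alternating_five (M 0 1) (M 0 2) (M 0 3) (M 0 4) (M 1 2)
    (M 1 3) (M 1 4) (M 2 3) (M 2 4) (M 3 4)
  refine ⟨l, hl, fun i => ?_⟩
  have e : ∑ x, h x * (l ⬝ᵥ x) * x i = ∑ j, M i j * l j := by
    simp only [dotProduct, Finset.mul_sum, Finset.sum_mul, M]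
    rw [Finset.sum_comm]
    exact Finset.sum_congr rfl fun j _ => Finset.sum_congr rfl fun x _ => by ring
  rw [e, Fin.sum_univ_five]
  fin_cases i
  · simpa [hM0] using h0
  · simpa [hM0, hM 1 0] using h1
  · simpa [hM0, hM 2 0, hM 2 1] using h2
  · simpa [hM0, hM 3 0, hM 3 1, hM 3 2] using h3
  · simpa [hM0, hM 4 0, hM 4 1, hM 4 2, hM 4 3] using h4

theorem exists_transvection {n : ℕ} {l : Fin (n + 1) → ZMod 2} (hl : l ≠ 0) :
    ∃ α w : Fin (n + 1) → ZMod 2, α ⬝ᵥ w = 0 ∧ ∀ x, l ⬝ᵥ x = tv α w x (Fin.last n) := by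
  obtain ⟨w, hw, hlw⟩ : ∃ w : Fin (n + 1) → ZMod 2, w (Fin.last n) = 1 ∧ l ⬝ᵥ w = 1 := by
    have h1 : ∀ a : ZMod 2, a ≠ 0 → a = 1 := by decide
    by_cases h : l (Fin.last n) = 0
    · obtain ⟨k, hk⟩ : ∃ k, l k ≠ 0 := by
        by_contra! H; exact hl (funext H)
      have hne : k ≠ Fin.last n := by rintro rfl; exact hk h
      refine ⟨Pi.single (Fin.last n) 1 + Pi.single k 1, ?_, ?_⟩
      · simp [hne.symm]
      · simp [dotProduct_add, h, h1 _ hk]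
    · exact ⟨Pi.single (Fin.last n) 1, by simp, by simp [h1 _ h]⟩
  refine ⟨Pi.single (Fin.last n) 1 + l, w, ?_, fun x => ?_⟩
  · rw [add_dotProduct, hlw, single_dotProduct, hw]; decide
  · simp only [tv, add_dotProduct, single_dotProduct, one_mul, Pi.add_apply, Pi.smul_apply,
      smul_eq_mul, hw, mul_one]
    rw [← add_assoc, CharTwo.add_self_eq_zero, zero_add]

theorem exists_quadratic_halves {h : BF 5} (h0 : ∑ x, h x = 0) (hi' : ∀ i, ∑ x, h x * x i = 0) :
    ∃ α w : Fin 5 → ZMod 2, α ⬝ᵥ w = 0 ∧ lo (h ∘ tv α w) ∈ RM 2 4 ∧ hi (h ∘ tv α w) ∈ RM 2 4 := by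
  obtain ⟨l, hl, hker⟩ := exists_kernel hi'
  obtain ⟨α, w, hαw, hlw⟩ := exists_transvection hl
  have hinv := tv_involutive hαw
  refine ⟨α, w, hαw, ?_⟩
  have hl0 : ∑ x, h x * (l ⬝ᵥ x) = 0 := by
    have := sum_mul_mem h0 hi' (RM_linear l 0)
    simpa using this
  have key1 : ∀ F ∈ RM 1 5, ∑ x, (h ∘ tv α w) x * F x = 0 := by
    intro F hF
    rw [sum_involutive hinv]
    exact sum_mul_mem h0 hi' (RM_comp hF (tv_mem α w))
  have key2 : ∀ F ∈ RM 1 5, ∑ x, hi (h ∘ tv α w) x * F (sn x 1) = 0 := by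
    intro F hF
    rw [← sum_hi]
    simp only [mul_assoc]
    rw [sum_involutive hinv (F := fun x => x (Fin.last 4) * F x)]
    simp only [← hlw, ← mul_assoc]
    exact sum_mul_mem hl0 hker (RM_comp hF (tv_mem α w))
  have key3 : ∀ F ∈ RM 1 5, ∑ x, lo (h ∘ tv α w) x * F (sn x 0) = 0 := by
    intro F hF
    have h1 := key1 F hF
    rw [sum_sn] at h1
    have h2 : ∑ x, (h ∘ tv α w) (sn x 1) * F (sn x 1) = 0 := key2 F hF
    rw [h2, add_zero] at h1
    exact h1
  have c1 := RM_const (r := 1) (n := 5) 1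
  constructor
  · refine RM_two_of_sums ?_ fun i => ?_
    · simpa only [mul_one] using key3 _ c1
    · simpa only [sn_castSucc] using key3 _ (RM_coord i.castSucc)
  · refine RM_two_of_sums ?_ fun i => ?_
    · simpa only [mul_one] using key2 _ c1
    · simpa only [sn_castSucc] using key2 _ (RM_coord i.castSucc)

theorem nl_concat_comm {n : ℕ} (a b : BF n) : nl 2 (concat a b) = nl 2 (concat b a) := by
  have key : ∀ a b : BF n, nl 2 (concat a b) ≤ nl 2 (concat b a) := by
    intro a b
    obtain ⟨g, hg, h⟩ := nl_attained 2 (concat b a)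
    have h1 := concat_mem (r := 1) (hi_mem hg) (lo_add_hi_mem hg)
    have h2 : nl 2 (concat a b) ≤ _ := nl_le (f := concat a b) h1
    rw [hd_concat, add_comm (lo g), ← add_assoc, BF_add_self, zero_add] at h2
    rw [h, ← concat_lo_hi g, hd_concat]
    omega
  exact le_antisymm (key a b) (key b a)

theorem hd_self {n : ℕ} (f : BF n) : hd f f = 0 := by simp [hd]

theorem hd_add_single {n : ℕ} (f : BF n) (p : Fin n → ZMod 2) :
    hd f (f + Pi.single p 1) = 1 := by
  rw [hd, Finset.card_eq_one]
  refine ⟨p, ?_⟩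
  ext x
  by_cases hx : x = p
  · simp [hx]
  · simp [hx]

theorem sum_add_eq {n : ℕ} {a b : BF n} {s t : ZMod 2} (ha : ∑ x, a x = s) (hb : ∑ x, b x = t) :
    ∑ x, (a + b) x = s + t := by
  rw [← ha, ← hb, ← Finset.sum_add_distrib]; rfl

theorem nl_concat_odd_even {a b : BF 4} (ha : ∑ x, a x = 1) (hb : ∑ x, b x = 0) :
    nl 2 (concat a b) ≤ 5 := by
  obtain ⟨p, hp⟩ := exists_delta ha
  by_cases H : ∀ u, |walsh (b + (a + Pi.single p 1)) u| ≤ 4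
  · have hq := (bent_quadratic H).2 (by
      rw [sum_add_eq hb (RM_sum_eq_zero (by norm_num) hp), add_zero])
    have hb' : b ∈ RM 2 4 := by
      have := RM_add hq hp
      rwa [add_assoc, BF_add_self, add_zero] at this
    obtain ⟨l, hl, hh⟩ := exists_affine_four_odd (g := a + b) (by rw [sum_add_eq ha hb, add_zero])
    have := nl_concat_le' (a := a) (b := b) hb' hl
    rw [hd_self] at this
    omega
  · push Not at H
    obtain ⟨u, hu⟩ := H
    obtain ⟨m, hm⟩ := walsh_even (f := b + (a + Pi.single p 1)) (by
      rw [sum_add_eq hb (RM_sum_eq_zero (by norm_num) hp), add_zero]) u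
    obtain ⟨l, hl, hh⟩ := exists_affine (b + (a + Pi.single p 1)) u
    have := nl_concat_le (a := a) (b := b) hp hl
    rw [hd_add_single] at this
    norm_num at hh
    rw [abs_eq_max_neg] at hh hu
    omega

theorem nl_concat_odd_odd {a b : BF 4} (ha : ∑ x, a x = 1) (hb : ∑ x, b x = 1) :
    nl 2 (concat a b) ≤ 6 := by
  obtain ⟨p, hp⟩ := exists_delta ha
  obtain ⟨l, hl, hh⟩ := exists_affine_four_odd (g := b + (a + Pi.single p 1)) (by
      rw [sum_add_eq hb (RM_sum_eq_zero (by norm_num) hp), add_zero])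
  have := nl_concat_le (a := a) (b := b) hp hl
  rw [hd_add_single] at this
  omega

theorem sum_lo_add_hi {n : ℕ} (h : BF (n + 1)) : ∑ x, h x = ∑ x, lo h x + ∑ x, hi h x := by
  rw [sum_sn]; rfl

theorem sum_hi_swap {n : ℕ} (h : BF (n + 1)) (i : Fin (n + 1)) :
    ∑ x, hi (h ∘ sw i (Fin.last n)) x = ∑ x, h x * x i := by
  have := sum_hi (h ∘ sw i (Fin.last n)) 1
  simp only [Pi.one_apply, mul_one] at this
  rw [← this, sum_involutive (sw_involutive _ _)]
  simp [sw]

theorem sum_lo_swap {n : ℕ} (h : BF (n + 1)) (i : Fin (n + 1)) (h0 : ∑ x, h x = 0) :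
    ∑ x, lo (h ∘ sw i (Fin.last n)) x = ∑ x, h x * x i := by
  have h1 := sum_lo_add_hi (h ∘ sw i (Fin.last n))
  have h2 := sum_involutive (sw_involutive i (Fin.last n)) h 1
  simp only [Pi.one_apply, mul_one, h0] at h2
  rw [h2, sum_hi_swap] at h1
  generalize ∑ x, lo _ x = s at *
  generalize ∑ x, h x * x i = t at *
  clear h2
  revert s t; decide

theorem nl_two_five_odd {h : BF 5} (h1 : ∑ x, h x = 1) : nl 2 h ≤ 5 := by
  rw [sum_lo_add_hi] at h1
  rw [← concat_lo_hi h]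
  rcases ZMod_two_cases (∑ x, lo h x) with ha | ha <;> rcases ZMod_two_cases (∑ x, hi h x) with hb | hb
  · rw [ha, hb] at h1; exact absurd h1 (by decide)
  · rw [nl_concat_comm]; exact nl_concat_odd_even hb ha
  · exact nl_concat_odd_even ha hb
  · rw [ha, hb] at h1; exact absurd h1 (by decide)

theorem nl_two_five (h : BF 5) : nl 2 h ≤ 6 := by
  rcases ZMod_two_cases (∑ x, h x) with h0 | h1
  · by_cases H : ∀ i, ∑ x, h x * x i = 0
    · obtain ⟨α, w, hαw, ha, hb⟩ := exists_quadratic_halves h0 H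
      rw [← nl_comp (tv_involutive hαw) (tv_mem α w), ← concat_lo_hi (h ∘ tv α w)]
      obtain ⟨l, hl, hh⟩ := exists_affine_four (hi (h ∘ tv α w) + lo (h ∘ tv α w))
      have := nl_concat_le (a := lo (h ∘ tv α w)) (b := hi (h ∘ tv α w)) ha hl
      rw [hd_self] at this
      omega
    · push Not at H
      obtain ⟨i, hi'⟩ := H
      replace hi' := (ZMod_two_cases _).resolve_left hi'
      rw [← nl_comp (sw_involutive i (Fin.last 4)) (sw_mem i _),
        ← concat_lo_hi (h ∘ sw i (Fin.last 4))]
      exact nl_concat_odd_odd (by rw [sum_lo_swap _ _ h0, hi']) (by rw [sum_hi_swap, hi'])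
  · exact (nl_two_five_odd h1).trans (by norm_num)

theorem nl_two_six (f : BF 6) : nl 2 f ≤ 18 := by
  rw [← concat_lo_hi f]
  obtain ⟨q, hq, h⟩ := nl_attained 2 (lo f)
  obtain ⟨l, hl, h'⟩ := exists_affine_five (hi f + q)
  have := nl_concat_le (a := lo f) (b := hi f) hq hl
  have := nl_two_five (lo f)
  omega

theorem sum_hat_three {n : ℕ} (F G H : (Fin n → ZMod 2) → ℤ) :
    ∑ u, hat F u * hat G u * hat H u = 2 ^ n * ∑ c, H c * ∑ x, F x * G (x + c) := by
  have e : ∀ u, hat F u * hat G u * hat H u = ∑ c, H c * (hat F u * hat G u * chi (u ⬝ᵥ c)) := by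
    intro u
    conv_lhs => rw [hat.eq_1 H, Finset.mul_sum]
    exact Finset.sum_congr rfl fun c _ => by ring
  simp only [e]
  rw [Finset.sum_comm, Finset.mul_sum]
  refine Finset.sum_congr rfl fun c _ => ?_
  rw [← Finset.mul_sum, sum_hat_mul]
  ring

theorem walsh_odd_ge_two {f : BF 4} (hf : ∑ x, f x = 1) (u) : 2 ≤ |walsh f u| := by
  obtain ⟨m, hm⟩ := walsh_odd hf u
  rw [hm, abs_eq_max_neg]
  omega

theorem autocorrelation_odd {f : BF 4} (hf : ∑ x, f x = 1) {a : Fin 4 → ZMod 2} (ha : a ≠ 0) :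
    ∃ k : ℤ, ∑ x, chi (f x) * chi (f (x + a)) = 8 * k + 4 := by
  have e : ∀ x, chi (f x) * chi (f (x + a)) = 1 - 2 * ((f x).val : ℤ) - 2 * ((f (x + a)).val : ℤ)
      + 4 * ((f x * f (x + a)).val : ℤ) := by
    intro x
    generalize f x = s
    generalize f (x + a) = t
    revert s t; decide
  have hshift : ∑ x, ((f (x + a)).val : ℤ) = ∑ x, ((f x).val : ℤ) :=
    Equiv.sum_comp (Equiv.addRight a) fun x => ((f x).val : ℤ)
  have h0 : ∑ x, f x * f (x + a) = 0 := by
    refine Finset.sum_involution (fun x _ => x + a) (fun x _ => ?_) (fun x _ _ h => ?_)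
      (fun x _ => Finset.mem_univ _) (fun x _ => ?_)
    · rw [add_assoc, vec_add_self, add_zero, mul_comm (f (x + a)), CharTwo.add_self_eq_zero]
    · exact ha (by simpa using h)
    · rw [add_assoc, vec_add_self, add_zero]
  have h1 := sum_eq_cast_val f
  have h2 := sum_eq_cast_val fun x => f x * f (x + a)
  rw [h0, ZMod.intCast_zmod_eq_zero_iff_dvd] at h2
  obtain ⟨k, hk⟩ := h2
  have h3 : ((∑ x, ((f x).val : ℤ) - 1 : ℤ) : ZMod 2) = 0 := by
    rw [Int.cast_sub, h1, hf]; decide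
  rw [ZMod.intCast_zmod_eq_zero_iff_dvd] at h3
  obtain ⟨m, hm⟩ := h3
  simp only [e, Finset.sum_add_distrib, Finset.sum_sub_distrib, ← Finset.mul_sum, hshift, hk,
    Finset.sum_const, card_four]
  push_cast at hm ⊢
  exact ⟨1 - m + k, by rw [nsmul_eq_mul]; push_cast; linarith⟩

/-- Indicator of the points where the Walsh coefficient has absolute value `6`. -/
def six (f : BF 4) (u : Fin 4 → ZMod 2) : ℤ := if |walsh f u| = 6 then 1 else 0

theorem hat_six {f : BF 4} (hf : ∑ x, f x = 1) (hs : ∀ u, |walsh f u| < 10) :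
    (∀ u, six f u = 0 ∨ six f u = 1 ∧ |walsh f u| = 6) ∧ hat (six f) 0 = 6 ∧
      ∀ a, a ≠ 0 → |hat (six f) a| = 2 := by
  have hsq : ∀ u, walsh f u * walsh f u = 4 + 32 * six f u := by
    intro u
    obtain ⟨m, hm⟩ := walsh_odd hf u
    have := hs u
    unfold six
    rw [hm] at *
    rw [abs_eq_max_neg] at *
    have h1 : -2 ≤ m := by omega
    have h2 : m ≤ 1 := by omega
    interval_cases m <;> simp
  have h01 : ∀ u, six f u = 0 ∨ six f u = 1 ∧ |walsh f u| = 6 := by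
    intro u
    by_cases h : |walsh f u| = 6 <;> simp [six, h]
  have hr : ∀ a, 32 * hat (six f) a + 4 * (if a = 0 then 2 ^ 4 else 0) =
      16 * ∑ x, chi (f x) * chi (f (x + a)) := by
    intro a
    have := sum_hat_mul (fun x => chi (f x)) (fun x => chi (f x)) a
    norm_num at this
    rw [← this, ← sum_chi_dot, hat, Finset.mul_sum, Finset.mul_sum, ← Finset.sum_add_distrib]
    refine Finset.sum_congr rfl fun u _ => ?_
    have := hsq u
    rw [walsh] at this
    rw [this, dotProduct_comm]
    ring
  have h6 : hat (six f) 0 = 6 := by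
    have := hr 0
    simp [chi_mul_self] at this
    omega
  have hge : ∀ a, a ≠ 0 → 2 ≤ |hat (six f) a| := by
    intro a ha
    obtain ⟨k, hk⟩ := autocorrelation_odd hf ha
    have := hr a
    rw [hk, if_neg ha] at this
    rw [abs_eq_max_neg]
    omega
  refine ⟨h01, h6, ?_⟩
  by_contra! H
  obtain ⟨a, ha, hne⟩ := H
  have hp := sum_hat_mul_zero (six f) (six f)
  have hs6 : ∑ x, six f x * six f x = 6 := by
    rw [← h6, hat]
    refine Finset.sum_congr rfl fun x _ => ?_
    rcases h01 x with h | h <;> simp [h]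
  rw [hs6, ← Finset.add_sum_erase _ _ (Finset.mem_univ 0), h6] at hp
  have hlt : ∑ _a ∈ Finset.univ.erase (0 : Fin 4 → ZMod 2), (4 : ℤ) <
      ∑ a ∈ Finset.univ.erase 0, hat (six f) a * hat (six f) a := by
    refine Finset.sum_lt_sum (fun b hb => ?_) ⟨a, by simpa using ha, ?_⟩
    · have := hge b (by simpa using hb)
      rw [← abs_mul_abs_self]; nlinarith
    · have := lt_of_le_of_ne (hge a ha) hne.symm
      rw [← abs_mul_abs_self]; nlinarith
  rw [Finset.sum_const, Finset.card_erase_of_mem (Finset.mem_univ _), card_four] at hlt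
  norm_num at hlt hp
  omega

theorem exists_triple_of_ten {a b c : BF 4} (hb : ∑ x, b x = 1) (hc : ∑ x, c x = 1)
    {u : Fin 4 → ZMod 2} (hu : 10 ≤ |walsh a u|) :
    ∃ v w, u + v + w = 0 ∧ 18 ≤ |walsh a u| + |walsh b v| + |walsh c w| := by
  obtain ⟨v, hv⟩ := exists_walsh_six hb
  refine ⟨v, u + v, vec_add_self _, ?_⟩
  have := walsh_odd_ge_two hc (u + v)
  linarith

theorem exists_triple {a b c : BF 4} (ha : ∑ x, a x = 1) (hb : ∑ x, b x = 1)
    (hc : ∑ x, c x = 1) :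
    ∃ u v w, u + v + w = 0 ∧ 18 ≤ |walsh a u| + |walsh b v| + |walsh c w| := by
  by_cases ha' : ∀ u, |walsh a u| < 10
  swap
  · push Not at ha'
    obtain ⟨u, hu⟩ := ha'
    obtain ⟨v, w, h⟩ := exists_triple_of_ten hb hc hu
    exact ⟨u, v, w, h⟩
  by_cases hb' : ∀ u, |walsh b u| < 10
  swap
  · push Not at hb'
    obtain ⟨u, hu⟩ := hb'
    obtain ⟨v, w, h, h'⟩ := exists_triple_of_ten ha hc hu
    exact ⟨v, u, w, by rw [← h]; abel, by linarith⟩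
  by_cases hc' : ∀ u, |walsh c u| < 10
  swap
  · push Not at hc'
    obtain ⟨u, hu⟩ := hc'
    obtain ⟨v, w, h, h'⟩ := exists_triple_of_ten ha hb hu
    exact ⟨v, w, u, by rw [← h]; abel, by linarith⟩
  by_contra! H
  obtain ⟨a01, a6, a2⟩ := hat_six ha ha'
  obtain ⟨b01, b6, b2⟩ := hat_six hb hb'
  obtain ⟨c01, c6, c2⟩ := hat_six hc hc'
  have h3 := sum_hat_three (six a) (six b) (six c)
  have h0 : ∑ y, six c y * ∑ x, six a x * six b (x + y) = 0 := by
    refine Finset.sum_eq_zero fun y _ => ?_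
    rw [Finset.mul_sum]
    refine Finset.sum_eq_zero fun x _ => ?_
    rcases a01 x with h | ⟨-, h1⟩
    · simp [h]
    rcases b01 (x + y) with h | ⟨-, h2⟩
    · simp [h]
    rcases c01 y with h | ⟨-, h3⟩
    · simp [h]
    have := H x (x + y) y (by
      rw [show x + (x + y) + y = (x + x) + (y + y) by abel, vec_add_self, vec_add_self, add_zero])
    omega
  rw [h0, ← Finset.add_sum_erase _ _ (Finset.mem_univ 0), a6, b6, c6] at h3
  have hle : ∑ _u ∈ Finset.univ.erase (0 : Fin 4 → ZMod 2), (-8 : ℤ) ≤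
      ∑ u ∈ Finset.univ.erase 0, hat (six a) u * hat (six b) u * hat (six c) u := by
    refine Finset.sum_le_sum fun u hu => ?_
    have hu' : u ≠ 0 := by simpa using hu
    have h := neg_abs_le (hat (six a) u * hat (six b) u * hat (six c) u)
    rw [abs_mul, abs_mul, a2 u hu', b2 u hu', c2 u hu'] at h
    linarith
  rw [Finset.sum_const, Finset.card_erase_of_mem (Finset.mem_univ _), card_four] at hle
  norm_num at hle h3
  omega

theorem nl_two_odd_pieces {p0 p1 p2 p3 : BF 4} (h0 : ∑ x, p0 x = 1) (h1 : ∑ x, p1 x = 1)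
    (h2 : ∑ x, p2 x = 1) (h3 : ∑ x, p3 x = 1) :
    nl 2 (concat (concat p0 p1) (concat p2 p3)) ≤ 16 := by
  obtain ⟨p, hp⟩ := exists_delta h0
  have hs := RM_sum_eq_zero (by norm_num) hp
  obtain ⟨u, v, w, huvw, h⟩ := exists_triple
    (a := p1 + (p0 + Pi.single p 1)) (b := p2 + (p0 + Pi.single p 1))
    (c := p3 + (p0 + Pi.single p 1)) (by rw [sum_add_eq h1 hs, add_zero])
    (by rw [sum_add_eq h2 hs, add_zero]) (by rw [sum_add_eq h3 hs, add_zero])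
  have key := nl_two_pieces p0 p1 p2 p3 hp (u0 := 0) (u1 := u) (u2 := v) (u3 := w)
    (by rw [zero_add, huvw])
  have h14 : walsh (p0 + (p0 + Pi.single p 1)) 0 = 14 := by
    have e := two_hd_affine (p0 + (p0 + Pi.single p 1)) 0 0
    simp only [zero_dotProduct, add_zero, chi_zero, one_mul] at e
    rw [hd_add_left, show (p0 + Pi.single p 1 + fun _ => (0 : ZMod 2) : BF 4) =
      p0 + Pi.single p 1 from by funext x; simp, hd_add_single] at e
    norm_num at e
    linarith
  rw [h14] at key
  norm_num at key
  omega

/-- The quadratic form in four variables with given coefficients. -/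
def qf (A : Fin 6 → ZMod 2) : BF 4 := fun x =>
  A 0 * (x 0 * x 1) + A 1 * (x 0 * x 2) + A 2 * (x 0 * x 3) + A 3 * (x 1 * x 2)
    + A 4 * (x 1 * x 3) + A 5 * (x 2 * x 3)

/-- The Pfaffian of the polar form of `qf A`. -/
def pf (A : Fin 6 → ZMod 2) : ZMod 2 := A 0 * A 5 + A 1 * A 4 + A 2 * A 3

theorem chi_sum_table : ∀ a b c d e f p q r s : ZMod 2,
    (a * f + b * e + c * d = 0 → 8 ∣
    ∑ x, ∑ y, ∑ z, ∑ w, chi (a * (x * y) + b * (x * z) + c * (x * w) + d * (y * z) + e * (y * w)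
      + f * (z * w) + (p * x + q * y + r * z + s * w))) ∧
    (a * f + b * e + c * d = 1 → 
    |∑ x, ∑ y, ∑ z, ∑ w, chi (a * (x * y) + b * (x * z) + c * (x * w) + d * (y * z) + e * (y * w)
      + f * (z * w) + (p * x + q * y + r * z + s * w))| = 4) := by
  decide +kernel

theorem sum_vecCons {n : ℕ} {M : Type*} [AddCommMonoid M] (F : (Fin (n + 1) → ZMod 2) → M) :
    ∑ y, F y = ∑ s, ∑ x : Fin n → ZMod 2, F (Matrix.vecCons s x) := by
  rw [← (Fin.consEquiv fun _ : Fin (n + 1) => ZMod 2).sum_comp, Fintype.sum_prod_type]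
  rfl

theorem sum_four {M : Type*} [AddCommMonoid M] (F : (Fin 4 → ZMod 2) → M) :
    ∑ y, F y = ∑ x, ∑ y, ∑ z, ∑ w, F ![x, y, z, w] := by
  simp only [sum_vecCons, Fintype.sum_unique]
  rfl

theorem walsh_qf (A : Fin 6 → ZMod 2) (u : Fin 4 → ZMod 2) :
    (pf A = 0 → 8 ∣ walsh (qf A) u) ∧ (pf A = 1 → |walsh (qf A) u| = 4) := by
  have h := chi_sum_table (A 0) (A 1) (A 2) (A 3) (A 4) (A 5) (u 0) (u 1) (u 2) (u 3)
  have e : walsh (qf A) u = ∑ x, ∑ y, ∑ z, ∑ w, chi (A 0 * (x * y) + A 1 * (x * z) + A 2 * (x * w)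
      + A 3 * (y * z) + A 4 * (y * w) + A 5 * (z * w)
      + (u 0 * x + u 1 * y + u 2 * z + u 3 * w)) := by
    rw [walsh_def, sum_four]
    simp only [dotProduct, Fin.sum_univ_four]
    rfl
  rw [e]
  exact h

theorem RM_two_four_form {q : BF 4} (hq : q ∈ RM 2 4) :
    ∃ A, ∃ l ∈ RM 1 4, q = qf A + l := by
  obtain ⟨B, u, c, h⟩ := RM_two_form hq
  refine ⟨![B 0 1 + B 1 0, B 0 2 + B 2 0, B 0 3 + B 3 0, B 1 2 + B 2 1, B 1 3 + B 3 1,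
    B 2 3 + B 3 2], _, RM_linear (u + fun i => B i i) c, ?_⟩
  funext x
  have hx : ∀ i, x i * x i = x i := by
    intro i; generalize x i = s; revert s; decide
  rw [h]
  simp only [Fin.sum_univ_four, qf, dotProduct, Pi.add_apply, hx, Matrix.cons_val]
  ring

theorem walsh_add_affine {n : ℕ} {l : BF n} (hl : l ∈ RM 1 n) :
    ∃ v, ∀ (f : BF n) (u), |walsh (f + l) u| = |walsh f (u + v)| := by
  obtain ⟨v, c, h⟩ := RM_one_form hl
  refine ⟨v, fun f u => ?_⟩
  have : walsh (f + l) u = chi c * walsh f (u + v) := by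
    rw [walsh_def, walsh_def, Finset.mul_sum]
    refine Finset.sum_congr rfl fun x _ => ?_
    simp only [Pi.add_apply, h, add_dotProduct, chi_add]; ring
  rw [this, abs_mul]
  rcases chi_eq_or c with h | h <;> simp [h]

theorem walsh_quadratic {q : BF 4} {A : Fin 6 → ZMod 2} {l : BF 4} (hl : l ∈ RM 1 4)
    (hq : q = qf A + l) : (pf A = 0 → ∀ u, 8 ∣ walsh q u) ∧ (pf A = 1 → ∀ u, |walsh q u| = 4) := by
  subst hq
  obtain ⟨v, hv⟩ := walsh_add_affine hl
  refine ⟨fun h u => ?_, fun h u => ?_⟩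
  · rw [← dvd_abs, hv, dvd_abs]
    exact (walsh_qf A _).1 h
  · rw [hv]
    exact (walsh_qf A _).2 h

theorem exists_signs_pos (a b c d : ℤ) (h : 0 ≤ a * b * c * d) :
    ∃ s t v w : ZMod 2, s + t + v + w = 0 ∧
      chi s * a + chi t * b + chi v * c + chi w * d = |a| + |b| + |c| + |d| := by
  obtain ⟨s, hs⟩ := exists_chi_mul a
  obtain ⟨t, ht⟩ := exists_chi_mul b
  obtain ⟨v, hv⟩ := exists_chi_mul c
  obtain ⟨w, hw⟩ := exists_chi_mul d
  rcases ZMod_two_cases (s + t + v + w) with h0 | h0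
  · exact ⟨s, t, v, w, h0, by linarith⟩
  · have hprod : |a| * |b| * |c| * |d| = -(a * b * c * d) := by
      have : chi s * chi t * chi v * chi w = -1 := by
        rw [← chi_add, ← chi_add, ← chi_add, h0]; rfl
      rw [← hs, ← ht, ← hv, ← hw]
      linear_combination a * b * c * d * this
    have hz : a * b * c * d = 0 := by
      have : 0 ≤ |a| * |b| * |c| * |d| := by positivity
      linarith
    have h11 : (1 : ZMod 2) + 1 = 0 := by decide
    rcases mul_eq_zero.1 hz with hz | rfl
    · rcases mul_eq_zero.1 hz with hz | rfl
      · rcases mul_eq_zero.1 hz with rfl | rfl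
        · exact ⟨s + 1, t, v, w, by linear_combination h0 + h11, by linarith⟩
        · exact ⟨s, t + 1, v, w, by linear_combination h0 + h11, by linarith⟩
      · exact ⟨s, t, v + 1, w, by linear_combination h0 + h11, by linarith⟩
    · exact ⟨s, t, v, w + 1, by linear_combination h0 + h11, by linarith⟩

theorem exists_signs (a b c d : ℤ) :
    ∃ s t v w : ZMod 2, s + t + v + w = 0 ∧
      -|a| + |b| + |c| + |d| ≤ chi s * a + chi t * b + chi v * c + chi w * d := by
  obtain ⟨t, ht⟩ := exists_chi_mul b
  obtain ⟨v, hv⟩ := exists_chi_mul c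
  obtain ⟨w, hw⟩ := exists_chi_mul d
  refine ⟨t + v + w, t, v, w, ?_, ?_⟩
  · rw [show t + v + w + t + v + w = (t + v + w) + (t + v + w) by ring]
    exact CharTwo.add_self_eq_zero _
  · rw [ht, hv, hw]
    have := neg_abs_le (chi (t + v + w) * a)
    rw [abs_mul] at this
    rcases chi_eq_or (t + v + w) with h | h <;> rw [h] at this ⊢ <;> norm_num at this ⊢ <;> linarith

/-- Some signed combination of four spectra with sign product one is at least `20`. -/
def Large (w0 w1 w2 w3 : (Fin 4 → ZMod 2) → ℤ) : Prop :=
  ∃ u, ∃ s t v w : ZMod 2, s + t + v + w = 0 ∧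
    20 ≤ chi s * w0 u + chi t * w1 u + chi v * w2 u + chi w * w3 u

theorem Large.swap01 {w0 w1 w2 w3 : (Fin 4 → ZMod 2) → ℤ} (h : Large w1 w0 w2 w3) :
    Large w0 w1 w2 w3 := by
  obtain ⟨u, s, t, v, w, h, h'⟩ := h
  exact ⟨u, t, s, v, w, by rw [← h]; abel, by linarith⟩

theorem Large.swap02 {w0 w1 w2 w3 : (Fin 4 → ZMod 2) → ℤ} (h : Large w2 w1 w0 w3) :
    Large w0 w1 w2 w3 := by
  obtain ⟨u, s, t, v, w, h, h'⟩ := h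
  exact ⟨u, v, t, s, w, by rw [← h]; abel, by linarith⟩

theorem Large.swap03 {w0 w1 w2 w3 : (Fin 4 → ZMod 2) → ℤ} (h : Large w3 w1 w2 w0) :
    Large w0 w1 w2 w3 := by
  obtain ⟨u, s, t, v, w, h, h'⟩ := h
  exact ⟨u, w, t, v, s, by rw [← h]; abel, by linarith⟩

theorem large_of_one_bent {w0 w1 w2 w3 : (Fin 4 → ZMod 2) → ℤ} (h0 : ∀ u, |w0 u| = 4)
    (h1 : ∀ u, 8 ∣ w1 u) (h2 : ∀ u, 8 ∣ w2 u) (h3 : ∀ u, 8 ∣ w3 u)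
    (h12 : ∑ u, w1 u * w2 u ≠ 0) : Large w0 w1 w2 w3 := by
  obtain ⟨u, -, hu⟩ := Finset.exists_ne_zero_of_sum_ne_zero h12
  have hw1 := Int.le_of_dvd (abs_pos.2 (left_ne_zero_of_mul hu)) ((dvd_abs _ _).2 (h1 u))
  have hw2 := Int.le_of_dvd (abs_pos.2 (right_ne_zero_of_mul hu)) ((dvd_abs _ _).2 (h2 u))
  have := h0 u
  by_cases hz : w3 u = 0
  · obtain ⟨s, t, v, w, h, h'⟩ := exists_signs_pos (w0 u) (w1 u) (w2 u) (w3 u) (by simp [hz])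
    exact ⟨u, s, t, v, w, h, by rw [h']; linarith [abs_nonneg (w3 u)]⟩
  · have hw3 := Int.le_of_dvd (abs_pos.2 hz) ((dvd_abs _ _).2 (h3 u))
    obtain ⟨s, t, v, w, h, h'⟩ := exists_signs (w0 u) (w1 u) (w2 u) (w3 u)
    exact ⟨u, s, t, v, w, h, by linarith⟩

theorem large_of_three_bent {w0 w1 w2 w3 : (Fin 4 → ZMod 2) → ℤ} (h0 : ∀ u, 8 ∣ w0 u)
    (h1 : ∀ u, |w1 u| = 4) (h2 : ∀ u, |w2 u| = 4) (h3 : ∀ u, |w3 u| = 4)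
    (h00 : ∑ u, w0 u ^ 2 = 256) (h01 : |∑ u, w0 u * w1 u| = 64)
    (h02 : |∑ u, w0 u * w2 u| = 64) (h03 : |∑ u, w0 u * w3 u| = 64) : Large w0 w1 w2 w3 := by
  by_contra H
  have hlt : ∀ u, |w0 u| < 16 := by
    intro u
    by_contra! hu
    obtain ⟨s, t, v, w, h, h'⟩ := exists_signs (w1 u) (w0 u) (w2 u) (w3 u)
    rw [h1, h2, h3] at h'
    exact H ⟨u, t, s, v, w, by rw [← h]; abel, by linarith⟩
  have hneg : ∀ u, w0 u ≠ 0 → w0 u * w1 u * w2 u * w3 u < 0 := by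
    intro u hu
    by_contra! hp
    have hw0 := Int.le_of_dvd (abs_pos.2 hu) ((dvd_abs _ _).2 (h0 u))
    obtain ⟨s, t, v, w, h, h'⟩ := exists_signs_pos _ _ _ _ hp
    rw [h1, h2, h3] at h'
    exact H ⟨u, s, t, v, w, h, by linarith⟩
  have hdvd : (256 : ℤ) ∣ ∑ u, (w0 u ^ 2 - 2 * (w0 u * w1 u) - 2 * (w0 u * w2 u)
      - 2 * (w0 u * w3 u)) := by
    refine Finset.dvd_sum fun u _ => ?_
    obtain ⟨a, ha⟩ := h0 u
    have hl := hlt u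
    have hn := hneg u
    rw [ha] at hl hn ⊢
    rw [abs_lt] at hl
    have ha1 : -1 ≤ a := by omega
    have ha2 : a ≤ 1 := by omega
    rcases (abs_eq (by norm_num)).1 (h1 u) with e1 | e1 <;>
    rcases (abs_eq (by norm_num)).1 (h2 u) with e2 | e2 <;>
    rcases (abs_eq (by norm_num)).1 (h3 u) with e3 | e3 <;>
    rw [e1, e2, e3] at hn ⊢ <;> interval_cases a <;> first | (norm_num; done) | norm_num at hn
  rw [Finset.sum_sub_distrib, Finset.sum_sub_distrib, Finset.sum_sub_distrib, ← Finset.mul_sum,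
    ← Finset.mul_sum, ← Finset.mul_sum, h00] at hdvd
  rw [abs_eq (by norm_num)] at h01 h02 h03
  omega

theorem qf_add (A B : Fin 6 → ZMod 2) : qf (A + B) = qf A + qf B := by
  funext x
  simp only [qf, Pi.add_apply]
  ring


theorem qf_eq_zero {A : Fin 6 → ZMod 2}
    (h : ∀ k l : Fin 4, k ≠ l → ∑ x, qf A x * (x k * x l) = 0) : A = 0 := by
  have h01 := h 0 1 (by decide)
  have h02 := h 0 2 (by decide)
  have h03 := h 0 3 (by decide)
  have h12 := h 1 2 (by decide)
  have h13 := h 1 3 (by decide)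
  have h23 := h 2 3 (by decide)
  simp only [sum_four, sum_ZMod_two, qf, Matrix.cons_val, mul_zero, mul_one, add_zero,
    zero_add] at h01 h02 h03 h12 h13 h23
  have h2 : (2 : ZMod 2) = 0 := rfl
  funext i
  fin_cases i <;> simp only [Pi.zero_apply, Fin.reduceFinMk, Fin.zero_eta, Fin.mk_one, Fin.isValue]
  · linear_combination h23 - (A 1 + A 2 + A 3 + A 4 + 2 * A 5) * h2
  · linear_combination h13 - (A 0 + A 2 + A 3 + 2 * A 4 + A 5) * h2
  · linear_combination h12 - (A 0 + A 1 + 2 * A 3 + A 4 + A 5) * h2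
  · linear_combination h03 - (A 0 + A 1 + 2 * A 2 + A 4 + A 5) * h2
  · linear_combination h02 - (A 0 + 2 * A 1 + A 2 + A 3 + A 5) * h2
  · linear_combination h01 - (2 * A 0 + A 1 + A 2 + A 3 + A 4) * h2

theorem sum_affine_mul {l : BF 4} (hl : l ∈ RM 1 4) (i j : Fin 4) :
    ∑ x, l x * (x i * x j) = 0 :=
  RM_sum_eq_zero (r := 1 + (1 + 1)) (by norm_num) (RM_mul hl (RM_mul (RM_coord i) (RM_coord j)))

theorem qf_eq_zero_of_mem {A : Fin 6 → ZMod 2} (h : qf A ∈ RM 1 4) : A = 0 :=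
  qf_eq_zero fun i j _ => sum_affine_mul h i j

theorem qf_zero : qf 0 = 0 := by
  funext x; simp [qf]

theorem RM_one_of_sums {q : BF 4} (hq : q ∈ RM 2 4)
    (h : ∀ i j : Fin 4, i ≠ j → ∑ x, q x * (x i * x j) = 0) : q ∈ RM 1 4 := by
  obtain ⟨A, l, hl, rfl⟩ := RM_two_four_form hq
  have hA : A = 0 := by
    refine qf_eq_zero fun i j hij => ?_
    have := h i j hij
    simpa only [Pi.add_apply, add_mul, Finset.sum_add_distrib, sum_affine_mul hl, add_zero]
      using this
  rwa [hA, qf_zero, zero_add]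

theorem pf_eq_one {q l : BF 4} {A : Fin 6 → ZMod 2} (hl : l ∈ RM 1 4) (hq : q = qf A + l)
    (h : ∀ u, |walsh q u| = 4) : pf A = 1 := by
  refine (ZMod_two_cases (pf A)).resolve_left fun h0 => ?_
  have h8 := (dvd_abs _ _).2 ((walsh_quadratic hl hq).1 h0 0)
  rw [h] at h8
  norm_num at h8

theorem pf_add_add (A B C : Fin 6 → ZMod 2) :
    pf (A + B + C) = pf (A + B) + pf (A + C) + pf (B + C) - pf A - pf B - pf C := by
  simp only [pf, Pi.add_apply]; ring

/-- Four quadratic functions with affine sum whose pairwise sums are bent. -/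
theorem large_of_quadratic {p0 p1 p2 p3 : BF 4} (h0 : p0 ∈ RM 2 4) (h1 : p1 ∈ RM 2 4)
    (h2 : p2 ∈ RM 2 4) (h3 : p3 ∈ RM 2 4) (hs : p0 + p1 + p2 + p3 ∈ RM 1 4)
    (h01 : ∀ u, |walsh (p0 + p1) u| = 4) (h02 : ∀ u, |walsh (p0 + p2) u| = 4)
    (h03 : ∀ u, |walsh (p0 + p3) u| = 4) (h12 : ∀ u, |walsh (p1 + p2) u| = 4)
    (h13 : ∀ u, |walsh (p1 + p3) u| = 4) (h23 : ∀ u, |walsh (p2 + p3) u| = 4) :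
    Large (walsh p0) (walsh p1) (walsh p2) (walsh p3) := by
  have corr : ∀ {a b : BF 4}, (∀ u, |walsh (a + b) u| = 4) →
      |∑ u, walsh a u * walsh b u| = 64 := by
    intro a b hab
    rw [sum_walsh_mul, abs_mul, hab]; norm_num
  have corr' : ∀ {a b : BF 4}, (∀ u, |walsh (a + b) u| = 4) →
      |∑ u, walsh b u * walsh a u| = 64 := fun hab => corr (by rwa [add_comm])
  have ne : ∀ {a b : BF 4}, (∀ u, |walsh (a + b) u| = 4) →
      ∑ u, walsh a u * walsh b u ≠ 0 := by
    intro a b hab h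
    have := corr hab
    rw [h] at this
    norm_num at this
  have sq : ∀ a : BF 4, ∑ u, walsh a u ^ 2 = 256 := fun a => by rw [sum_walsh_sq]; norm_num
  obtain ⟨A0, l0, m0, e0⟩ := RM_two_four_form h0
  obtain ⟨A1, l1, m1, e1⟩ := RM_two_four_form h1
  obtain ⟨A2, l2, m2, e2⟩ := RM_two_four_form h2
  obtain ⟨A3, l3, m3, e3⟩ := RM_two_four_form h3
  obtain ⟨z0, o0⟩ := walsh_quadratic m0 e0
  obtain ⟨z1, o1⟩ := walsh_quadratic m1 e1
  obtain ⟨z2, o2⟩ := walsh_quadratic m2 e2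
  obtain ⟨z3, o3⟩ := walsh_quadratic m3 e3
  have hA : A0 + A1 + A2 + A3 = 0 := by
    refine qf_eq_zero_of_mem ?_
    have : qf (A0 + A1 + A2 + A3) = (p0 + p1 + p2 + p3) + (l0 + l1 + l2 + l3) := by
      rw [qf_add, qf_add, qf_add, e0, e1, e2, e3]
      have h := BF_add_self (l0 + l1 + l2 + l3)
      linear_combination -h
    rw [this]
    exact RM_add hs (RM_add (RM_add (RM_add m0 m1) m2) m3)
  have hA3 : A3 = A0 + A1 + A2 := by
    have h := vec_add_self (A0 + A1 + A2)
    linear_combination hA - h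
  have b01 : pf (A0 + A1) = 1 := pf_eq_one (RM_add m0 m1) (by rw [qf_add, e0, e1]; ring) h01
  have b02 : pf (A0 + A2) = 1 := pf_eq_one (RM_add m0 m2) (by rw [qf_add, e0, e2]; ring) h02
  have b12 : pf (A1 + A2) = 1 := pf_eq_one (RM_add m1 m2) (by rw [qf_add, e1, e2]; ring) h12
  have hp : pf A3 = 1 + 1 + 1 - pf A0 - pf A1 - pf A2 := by
    rw [hA3, pf_add_add, b01, b02, b12]
  rcases ZMod_two_cases (pf A0) with c0 | c0 <;> rcases ZMod_two_cases (pf A1) with c1 | c1 <;>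
    rcases ZMod_two_cases (pf A2) with c2 | c2 <;> rw [c0, c1, c2] at hp
  · exact .swap03 (large_of_one_bent (o3 hp) (z1 c1) (z2 c2) (z0 c0) (ne h12))
  · exact .swap02 (large_of_one_bent (o2 c2) (z1 c1) (z0 c0) (z3 hp)
      (ne (by rwa [add_comm])))
  · exact .swap01 (large_of_one_bent (o1 c1) (z0 c0) (z2 c2) (z3 hp) (ne h02))
  · exact large_of_three_bent (z0 c0) (o1 c1) (o2 c2) (o3 hp) (sq _) (corr h01) (corr h02)
      (corr h03)
  · exact large_of_one_bent (o0 c0) (z1 c1) (z2 c2) (z3 hp) (ne h12)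
  · exact .swap01 (large_of_three_bent (z1 c1) (o0 c0) (o2 c2) (o3 hp) (sq _) (corr' h01)
      (corr h12) (corr h13))
  · exact .swap02 (large_of_three_bent (z2 c2) (o1 c1) (o0 c0) (o3 hp) (sq _) (corr' h12)
      (corr' h02) (corr h23))
  · exact .swap03 (large_of_three_bent (z3 hp) (o1 c1) (o2 c2) (o0 c0) (sq _) (corr' h13)
      (corr' h23) (corr' h03))

/-- The spectral condition on the four pieces of a function in six variables that prevents a
second order approximation at distance less than `18`. -/
def Far (p0 p1 p2 p3 : BF 4) : Prop :=
  ∀ q ∈ RM 2 4, ∀ u0 u1 u2 u3 : Fin 4 → ZMod 2, u0 + u1 + u2 + u3 = 0 →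
    |walsh (p0 + q) u0| + |walsh (p1 + q) u1| + |walsh (p2 + q) u2| + |walsh (p3 + q) u3| ≤ 28

theorem far_of_nl {p0 p1 p2 p3 : BF 4}
    (h : 18 ≤ nl 2 (concat (concat p0 p1) (concat p2 p3))) : Far p0 p1 p2 p3 := by
  intro q hq u0 u1 u2 u3 hu
  have h1 := nl_two_pieces p0 p1 p2 p3 hq hu
  have h2 : (18 : ℤ) ≤ nl 2 (concat (concat p0 p1) (concat p2 p3)) := by exact_mod_cast h
  norm_num at h1
  linarith

theorem Far.swap01 {p0 p1 p2 p3 : BF 4} (h : Far p0 p1 p2 p3) : Far p1 p0 p2 p3 := by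
  intro q hq u0 u1 u2 u3 hu
  have := h q hq u1 u0 u2 u3 (by rw [← hu]; abel)
  linarith

theorem Far.swap12 {p0 p1 p2 p3 : BF 4} (h : Far p0 p1 p2 p3) : Far p0 p2 p1 p3 := by
  intro q hq u0 u1 u2 u3 hu
  have := h q hq u0 u2 u1 u3 (by rw [← hu]; abel)
  linarith

theorem Far.swap23 {p0 p1 p2 p3 : BF 4} (h : Far p0 p1 p2 p3) : Far p0 p1 p3 p2 := by
  intro q hq u0 u1 u2 u3 hu
  have := h q hq u0 u1 u3 u2 (by rw [← hu]; abel)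
  linarith

theorem walsh_add_dot {n : ℕ} (f : BF n) (v u) :
    walsh (f + fun x => v ⬝ᵥ x) u = walsh f (u + v) := by
  rw [walsh_def, walsh_def]
  refine Finset.sum_congr rfl fun x _ => ?_
  rw [Pi.add_apply, add_dotProduct]
  congr 1; ring

theorem walsh_zero_zero : walsh (0 : BF 4) 0 = 16 := by
  rw [walsh_def]; simp

theorem Far.walsh_le {p0 p1 p2 p3 : BF 4} (h : Far p0 p1 p2 p3) (h0 : p0 ∈ RM 2 4)
    (h1 : ∑ x, p1 x = 0) (v) : |walsh (p0 + p1) v| ≤ 4 := by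
  by_contra! H
  obtain ⟨m, hm⟩ := walsh_even (f := p0 + p1)
    (by simpa using sum_add_eq (RM_sum_eq_zero (by norm_num) h0) h1) v
  obtain ⟨u, hu⟩ := exists_pair (p2 + p0) (p3 + p0 + fun x => v ⬝ᵥ x)
  rw [walsh_add_dot] at hu
  have hf := h p0 h0 0 v u (u + v) (by
    have h1 := vec_add_self u
    have h2 := vec_add_self v
    linear_combination h1 + h2)
  rw [BF_add_self, walsh_zero_zero, add_comm p1 p0] at hf
  have : 8 ≤ |walsh (p0 + p1) v| := by
    rw [hm, abs_eq_max_neg] at H ⊢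
    omega
  norm_num at hf
  linarith

theorem Far.bent {p0 p1 p2 p3 : BF 4} (h : Far p0 p1 p2 p3) (h0 : p0 ∈ RM 2 4)
    (h1 : ∑ x, p1 x = 0) : p1 ∈ RM 2 4 ∧ ∀ v, |walsh (p0 + p1) v| = 4 := by
  obtain ⟨h4, hm⟩ := bent_quadratic (h.walsh_le h0 h1)
  refine ⟨?_, h4⟩
  have := RM_add h0 (hm (by simpa using sum_add_eq (RM_sum_eq_zero (by norm_num) h0) h1))
  rwa [← add_assoc, BF_add_self, zero_add] at this

theorem walsh_add_affine_bent {n : ℕ} {c : ℤ} {f l : BF n} (hl : l ∈ RM 1 n)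
    (h : ∀ u, |walsh f u| = c) (u) : |walsh (f + l) u| = c := by
  obtain ⟨v, hv⟩ := walsh_add_affine hl
  rw [hv, h]

theorem nl_one_of_far {p0 p1 p2 p3 : BF 4} (h : Far p0 p1 p2 p3) (h0 : p0 ∈ RM 2 4)
    (h1 : p1 ∈ RM 2 4) (h2 : ∑ x, p2 x = 0) (h3 : ∑ x, p3 x = 0)
    (hs : p2 ∈ RM 2 4 → p3 ∈ RM 2 4 → p0 + p1 + p2 + p3 ∈ RM 1 4) {q : BF 6}
    (hq : q ∈ RM 2 6) : nl 1 (concat (concat p0 p1) (concat p2 p3) + q) ≤ 22 := by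
  have b01 := (h.bent h0 (RM_sum_eq_zero (by norm_num) h1)).2
  obtain ⟨m2, b02⟩ := h.swap12.bent h0 h2
  obtain ⟨m3, b03⟩ := h.swap23.swap12.bent h0 h3
  have b12 := (h.swap01.swap12.bent h1 h2).2
  have b13 := (h.swap01.swap23.swap12.bent h1 h3).2
  have b23 := (h.swap12.swap01.swap23.swap12.bent m2 h3).2
  have hl := lo_mem hq
  have hh := hi_mem hq
  have hd := lo_add_hi_mem (r := 1) hq
  set q0 := lo (lo q) with e0
  set q1 := hi (lo q) with e1
  set q2 := lo (hi q) with e2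
  set q3 := hi (hi q) with e3
  have d01 : q0 + q1 ∈ RM 1 4 := lo_add_hi_mem (r := 1) hl
  have d23 : q2 + q3 ∈ RM 1 4 := lo_add_hi_mem (r := 1) hh
  have d02 : q0 + q2 ∈ RM 1 4 := lo_mem hd
  have d13 : q1 + q3 ∈ RM 1 4 := hi_mem hd
  have d03 : q0 + q3 ∈ RM 1 4 := by
    have e : q0 + q3 = (q0 + q1) + (q1 + q3) := by linear_combination -BF_add_self q1
    rw [e]; exact RM_add d01 d13
  have d12 : q1 + q2 ∈ RM 1 4 := by
    have e : q1 + q2 = (q0 + q1) + (q0 + q2) := by linear_combination -BF_add_self q0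
    rw [e]; exact RM_add d01 d02
  have pair : ∀ {a b c d : BF 4}, (∀ u, |walsh (a + b) u| = 4) → c + d ∈ RM 1 4 →
      ∀ u, |walsh ((a + c) + (b + d)) u| = 4 := by
    intro a b c d hab hcd
    rw [show (a + c) + (b + d) = (a + b) + (c + d) by ring]
    exact walsh_add_affine_bent hcd hab
  have hsum : (p0 + q0) + (p1 + q1) + (p2 + q2) + (p3 + q3) ∈ RM 1 4 := by
    rw [show (p0 + q0) + (p1 + q1) + (p2 + q2) + (p3 + q3)
      = (p0 + p1 + p2 + p3) + ((q0 + q1) + (q2 + q3)) by ring]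
    exact RM_add (hs m2 m3) (RM_add d01 d23)
  obtain ⟨u, s, t, v, w, hc, hL⟩ := large_of_quadratic (RM_add h0 (lo_mem hl))
    (RM_add h1 (hi_mem hl)) (RM_add m2 (lo_mem hh)) (RM_add m3 (hi_mem hh)) hsum
    (pair b01 d01) (pair b02 d02) (pair b03 d03) (pair b12 d12) (pair b13 d13) (pair b23 d23)
  have key := nl_one_pieces (p0 + q0) (p1 + q1) (p2 + q2) (p3 + q3) u s t v w hc
  have hfq : concat (concat (p0 + q0) (p1 + q1)) (concat (p2 + q2) (p3 + q3))
      = concat (concat p0 p1) (concat p2 p3) + q := by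
    rw [← concat_add, ← concat_add, ← concat_add, e0, e1, e2, e3, concat_lo_hi, concat_lo_hi,
      concat_lo_hi]
  rw [hfq] at key
  have hk := le_trans key (sub_le_sub_left (le_trans hL (le_abs_self _)) _)
  norm_num at hk
  omega

theorem sum_halves {f : BF 6} (h : 18 ≤ nl 2 f) : ∑ x, lo f x = 0 ∧ ∑ x, hi f x = 0 := by
  have hodd : ∀ a b : BF 5, ∑ x, a x = 1 → nl 2 (concat a b) ≤ 17 := by
    intro a b ha
    obtain ⟨q, hq, hq'⟩ := nl_attained 2 a
    obtain ⟨l, hl, hl'⟩ := exists_affine_five (b + q)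
    have := nl_two_five_odd ha
    have := nl_concat_le (a := a) (b := b) hq hl
    omega
  constructor
  · refine (ZMod_two_cases _).resolve_right fun h1 => ?_
    have := hodd _ (hi f) h1
    rw [concat_lo_hi] at this
    omega
  · refine (ZMod_two_cases _).resolve_right fun h1 => ?_
    have := hodd _ (lo f) h1
    rw [nl_concat_comm, concat_lo_hi] at this
    omega

theorem sum_mul_coord_of_nl {f : BF 6} (h : 18 ≤ nl 2 f) (i : Fin 6) : ∑ x, f x * x i = 0 := by
  rw [← sum_hi_swap f i]
  exact (sum_halves (by rwa [nl_comp (sw_involutive _ _) (sw_mem _ _)])).2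

theorem sum_hi_hi_of_nl {f : BF 6} (h : 18 ≤ nl 2 f) : ∑ x, hi (hi f) x = 0 := by
  refine (ZMod_two_cases _).resolve_right fun h1 => ?_
  obtain ⟨h2, h3⟩ := sum_halves h
  have h4 := sum_mul_coord_of_nl h (Fin.last 4).castSucc
  rw [sum_sn] at h4
  simp only [sn_castSucc] at h4
  have e0 := sum_hi (lo f) (fun _ => 1)
  have e1 := sum_hi (hi f) (fun _ => 1)
  simp only [mul_one] at e0 e1
  have h5 : ∑ x, hi (lo f) x + ∑ x, hi (hi f) x = 0 := by
    rw [← e0, ← e1]; exact h4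
  rw [sum_lo_add_hi] at h2 h3
  rw [h1] at h3 h5
  have hz : ∀ a : ZMod 2, a + 1 = 0 → a = 1 := by decide
  have h6 := hz _ h5
  rw [h6] at h2
  have := nl_two_odd_pieces (hz _ h2) h6 (hz _ h3) h1
  rw [concat_lo_hi, concat_lo_hi, concat_lo_hi] at this
  omega

theorem sum_hi_hi (f : BF 6) : ∑ x, hi (hi f) x = ∑ x, f x * (x 5 * x 4) := by
  have e1 := sum_hi (hi f) (fun _ => 1)
  have e2 := sum_hi f (fun x => x (Fin.last 4).castSucc)
  simp only [mul_one, sn_castSucc] at e1 e2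
  rw [← e1, ← e2]
  exact Finset.sum_congr rfl fun x _ => mul_assoc _ _ _

theorem sum_mul_coord_mul_coord_of_nl {f : BF 6} (h : 18 ≤ nl 2 f) {i j : Fin 6} (hij : i ≠ j) :
    ∑ x, f x * (x i * x j) = 0 := by
  have hf1 : 18 ≤ nl 2 (f ∘ sw i 5) := by rwa [nl_comp (sw_involutive _ _) (sw_mem _ _)]
  have hf2 : 18 ≤ nl 2 ((f ∘ sw i 5) ∘ sw (Equiv.swap i 5 j) 4) := by
    rwa [nl_comp (sw_involutive _ _) (sw_mem _ _)]
  have := sum_hi_hi_of_nl hf2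
  rw [sum_hi_hi, sum_involutive (sw_involutive _ _) _ (fun x => x 5 * x 4),
    sum_involutive (sw_involutive _ _) f
      (fun y => sw (Equiv.swap i 5 j) 4 y 5 * sw (Equiv.swap i 5 j) 4 y 4)] at this
  rw [← this]
  refine Finset.sum_congr rfl fun x _ => ?_
  have h5 : Equiv.swap (Equiv.swap i 5 j) 4 (5 : Fin 6) = 5 := by
    refine Equiv.swap_apply_of_ne_of_ne ?_ (by decide)
    intro h
    apply hij
    have := congrArg (Equiv.swap i 5) h
    simpa using this
  simp only [sw, Function.comp_apply, h5, Equiv.swap_apply_right, Equiv.swap_apply_self]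

theorem sum_lo_mul_coord {n : ℕ} (f : BF (n + 1)) (i : Fin n) :
    ∑ x, lo f x * x i
      = ∑ x, f x * x i.castSucc - ∑ x, f x * (x (Fin.last n) * x i.castSucc) := by
  rw [sum_sn, sum_sn]
  simp [lo]

theorem sum_pieces_mul {n : ℕ} (f : BF (n + 1 + 1)) (i j : Fin n) :
    ∑ x, (lo (lo f) + hi (lo f) + lo (hi f) + hi (hi f)) x * (x i * x j)
      = ∑ x, f x * (x i.castSucc.castSucc * x j.castSucc.castSucc) := by
  rw [sum_sn, sum_sn, sum_sn]
  simp only [sn_castSucc, Pi.add_apply, add_mul, Finset.sum_add_distrib]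
  rw [add_assoc]
  rfl

theorem nl_one_of_quadratic_halves {g q : BF 6} (hn : 18 ≤ nl 2 g) (hlo : lo (lo g) ∈ RM 2 4)
    (hhi : hi (lo g) ∈ RM 2 4) (hq : q ∈ RM 2 6) : nl 1 (g + q) ≤ 22 := by
  have h3 := sum_hi_hi_of_nl hn
  have h2 : ∑ x, lo (hi g) x = 0 := by
    have := (sum_halves hn).2
    rwa [sum_lo_add_hi, h3, add_zero] at this
  have hg : concat (concat (lo (lo g)) (hi (lo g))) (concat (lo (hi g)) (hi (hi g))) = g := by
    rw [concat_lo_hi, concat_lo_hi, concat_lo_hi]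
  have hs (m2 : lo (hi g) ∈ RM 2 4) (m3 : hi (hi g) ∈ RM 2 4) :
      lo (lo g) + hi (lo g) + lo (hi g) + hi (hi g) ∈ RM 1 4 := by
    refine RM_one_of_sums (RM_add (RM_add (RM_add hlo hhi) m2) m3) fun i j hij => ?_
    rw [sum_pieces_mul]
    exact sum_mul_coord_mul_coord_of_nl hn (by simpa using hij)
  have := nl_one_of_far (far_of_nl (by rwa [hg])) hlo hhi h2 h3 hs hq
  rwa [hg] at this

theorem exists_involutive_quadratic_halves {f : BF 6} (h : 18 ≤ nl 2 f) :
    ∃ σ : (Fin 6 → ZMod 2) → Fin 6 → ZMod 2, Function.Involutive σ ∧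
      (∀ i, (fun x => σ x i) ∈ RM 1 6) ∧ lo (lo (f ∘ σ)) ∈ RM 2 4 ∧ hi (lo (f ∘ σ)) ∈ RM 2 4 := by
  obtain ⟨α, w, hαw, hlo, hhi⟩ := exists_quadratic_halves (sum_halves h).1 fun i => by
    rw [sum_lo_mul_coord, sum_mul_coord_of_nl h,
      sum_mul_coord_mul_coord_of_nl h (Fin.castSucc_lt_last i).ne', sub_zero]
  have hσ : lo (f ∘ tv (sn α 0) (sn w 0)) = lo f ∘ tv α w := by
    funext x
    exact congrArg f (tv_sn α w x 0)
  refine ⟨tv (sn α 0) (sn w 0), tv_involutive ?_, tv_mem _ _, ?_, ?_⟩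
  · rw [sn_dot, hαw, mul_zero, add_zero]
  · rwa [hσ]
  · rwa [hσ]

theorem nl_one_of_nl_two {f q : BF 6} (h : 18 ≤ nl 2 f) (hq : q ∈ RM 2 6) :
    nl 1 (f + q) ≤ 22 := by
  obtain ⟨σ, hinv, hmem, hlo, hhi⟩ := exists_involutive_quadratic_halves h
  rw [← nl_comp hinv hmem]
  exact nl_one_of_quadratic_halves (h.trans_eq (nl_comp hinv hmem f).symm) hlo hhi (RM_comp hq hmem)

/-- If `nl_2(f1) = 18` then `nl_2(f1||f2) ≤ 40`. -/
theorem stmt16 (f1 f2 : BF 6) (h1 : nl 2 f1 = 18) :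
    nl 2 (concat f1 f2) ≤ 40 := by
  obtain ⟨q, hq, hq'⟩ := nl_attained 2 f2
  obtain ⟨l, hl, hl'⟩ := nl_attained 1 (f1 + q)
  have := nl_two_six f2
  have := nl_one_of_nl_two h1.ge hq
  have := nl_concat_le' (a := f1) (b := f2) hq hl
  omega
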